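/- (Key single-tile bilinear estimate with decay.) Assume BH(s,r) holds for some 3/2 < s < 2 and r < s'. Let K < K' and J > J' be nonnegative integers, let Ω(K) ⊆ [0,1]² be measurable with all nonempty vertical fibers of 𝓗¹-measure ∼ 2^{-K} and |π₁(Ω(K))| ∼ 2^{-J}, and similarly for Ω(K') with parameters K', J'; assume Vargas's estimate ∥𝓔χ_{Ω'}∥_{2s} ≲ |Ω(K)|^{1/s'} holds for all Ω' ⊆ Ω(K) and likewise for Ω(K'). Suppose J + K and J' + K' satisfy |J−J'| ≥ |K−K'|/2 (so that |Ω(K)| ≳ |Ω(K')|, after relabeling). Then there are admissible constants C, c₀ > 0 such that for any tiles τ ∈ 𝓓_{J,K}, τ' ∈ 𝓓_{J',K'} and any dyadic 0 < δ ≤ 1, ∥𝓔χ_{τ ∩ Ω(K)} · 𝓔χ_{τ' ∩ Ω(K')}∥_{L^s(ℝ³)} ≲ δ^{-C} 2^{-c₀|K−K'|} |Ω(K)|^{1/s'} |Ω(K')|^{1/s'}. -/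

import Mathlib

open MeasureTheory Set
open scoped ENNReal

/-- The extension operator for the hyperbolic paraboloid `τ = ξ₁ξ₂` in `ℝ³`:
`𝓔f(t,x) = ∫_{ℝ²} e^{i(tξ₁ξ₂ + x·ξ)} f(ξ) dξ`. -/
noncomputable def extOp (f : ℝ × ℝ → ℂ) (p : ℝ × ℝ × ℝ) : ℂ :=
  ∫ ξ : ℝ × ℝ,
    Complex.exp (Complex.I * (p.1 * ξ.1 * ξ.2 + p.2.1 * ξ.1 + p.2.2 * ξ.2 : ℝ)) * f ξ

/-- Characteristic function of a set, valued in `ℂ`. -/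
noncomputable def chi (Ω : Set (ℝ × ℝ)) : ℝ × ℝ → ℂ := Ω.indicator fun _ => 1

/-- The axis-parallel unit square with lower-left corner `(a, b)`. -/
def unitSq (a b : ℝ) : Set (ℝ × ℝ) := Icc a (a + 1) ×ˢ Icc b (b + 1)

/-- Bilinear hypothesis BH(s,r) with constant `A`: a bilinear adjoint restriction estimate
`∥𝓔f·𝓔g∥_{L^s} ≤ A ∥f∥_{L^r} ∥g∥_{L^r}` whenever `f, g` are supported in `1 × 1`
axis-parallel squares whose projections onto each coordinate axis are separated by a
distance between `1` and `4` (equivalently, the corners satisfy `2 ≤ |aᵢ - bᵢ| ≤ 5`). -/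
def BH (s r A : ℝ) : Prop :=
  ∀ a₁ a₂ b₁ b₂ : ℝ, 2 ≤ |a₁ - b₁| → |a₁ - b₁| ≤ 5 → 2 ≤ |a₂ - b₂| → |a₂ - b₂| ≤ 5 →
    ∀ f g : ℝ × ℝ → ℂ,
      Function.support f ⊆ unitSq a₁ a₂ → Function.support g ⊆ unitSq b₁ b₂ →
      eLpNorm (fun p => extOp f p * extOp g p) (ENNReal.ofReal s) volume ≤
        ENNReal.ofReal A * eLpNorm f (ENNReal.ofReal r) volume *
          eLpNorm g (ENNReal.ofReal r) volume


/-- The dyadic interval `[m·2⁻ⁿ, (m+1)·2⁻ⁿ]`. -/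
def dyadicIcc (n m : ℤ) : Set ℝ := Icc ((m : ℝ) * 2 ^ (-n)) (((m : ℝ) + 1) * 2 ^ (-n))

/-- A tile in `𝓓_{j,k}`: a product of a dyadic interval of length `2⁻ʲ` with one of
length `2⁻ᵏ`. -/
def tile (j k m m' : ℤ) : Set (ℝ × ℝ) := dyadicIcc j m ×ˢ dyadicIcc k m'

/-- A dyadic number is one of the form `2ⁿ`, `n ∈ ℤ`. -/
def IsDyadic (x : ℝ) : Prop := ∃ n : ℤ, x = 2 ^ n

/-- The vertical fiber of `Ω ⊆ ℝ²` over `x`: `{η : (x, η) ∈ Ω}`. -/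
def vFiber (Ω : Set (ℝ × ℝ)) (x : ℝ) : Set ℝ := {y | (x, y) ∈ Ω}

/-- `Ω(K) = {ξ ∈ Ω : 2^{-K-1} ≤ 𝓗¹({η : (ξ₁,η) ∈ Ω}) ≤ 2^{-K+1}}`, the piece of `Ω` whose
vertical fibers have length about `2⁻ᴷ`. -/
noncomputable def fiberPiece (Ω : Set (ℝ × ℝ)) (K : ℕ) : Set (ℝ × ℝ) :=
  {ξ ∈ Ω | (2 : ℝ≥0∞) ^ (-(K : ℤ) - 1) ≤ volume (vFiber Ω ξ.1) ∧
    volume (vFiber Ω ξ.1) ≤ (2 : ℝ≥0∞) ^ (-(K : ℤ) + 1)}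

/-- `VargasBound s Ω c` says `∥𝓔χ_{Ω'}∥_{L^{2s}} ≤ c·|Ω|^{1/s'}` for every measurable
`Ω' ⊆ Ω` (here `1/s' = 1 - 1/s`). -/
def VargasBound (s : ℝ) (Ω : Set (ℝ × ℝ)) (c : ℝ) : Prop :=
  ∀ Ω' ⊆ Ω, MeasurableSet Ω' →
    eLpNorm (extOp (chi Ω')) (ENNReal.ofReal (2 * s)) volume ≤
      ENNReal.ofReal c * volume Ω ^ (1 - 1 / s)


open MeasureTheory Set
open scoped ENNReal

/-- The phase factor. -/
noncomputable def ph (p : ℝ × ℝ × ℝ) (ξ : ℝ × ℝ) : ℂ :=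
  Complex.exp (Complex.I * (p.1 * ξ.1 * ξ.2 + p.2.1 * ξ.1 + p.2.2 * ξ.2 : ℝ))

theorem extOp_eq (f : ℝ × ℝ → ℂ) (p : ℝ × ℝ × ℝ) : extOp f p = ∫ ξ, ph p ξ * f ξ := rfl

theorem norm_ph (p : ℝ × ℝ × ℝ) (ξ : ℝ × ℝ) : ‖ph p ξ‖ = 1 := by
  unfold ph; rw [mul_comm]; exact Complex.norm_exp_ofReal_mul_I _

theorem continuous_ph : Continuous (fun q : (ℝ × ℝ × ℝ) × (ℝ × ℝ) => ph q.1 q.2) := by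
  unfold ph; fun_prop

theorem continuous_ph' (p : ℝ × ℝ × ℝ) : Continuous (ph p) := by
  unfold ph; fun_prop

theorem measurable_extOp {f : ℝ × ℝ → ℂ} (hf : Measurable f) : Measurable (extOp f) := by
  have : StronglyMeasurable (fun q : (ℝ × ℝ × ℝ) × (ℝ × ℝ) => ph q.1 q.2 * f q.2) :=
    (continuous_ph.measurable.mul (hf.comp measurable_snd)).stronglyMeasurable
  exact (this.integral_prod_right (ν := volume)).measurable

theorem integrable_ph_mul {f : ℝ × ℝ → ℂ} (hf : Integrable f) (p : ℝ × ℝ × ℝ) :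
    Integrable (fun ξ => ph p ξ * f ξ) := by
  refine hf.bdd_mul (c := 1) (continuous_ph' p).aestronglyMeasurable ?_
  exact Filter.Eventually.of_forall fun ξ => (norm_ph p ξ).le

theorem extOp_sub {f g : ℝ × ℝ → ℂ} (hf : Integrable f) (hg : Integrable g)
    (p : ℝ × ℝ × ℝ) : extOp (fun ξ => f ξ - g ξ) p = extOp f p - extOp g p := by
  simp only [extOp_eq, mul_sub]
  exact integral_sub (integrable_ph_mul hf p) (integrable_ph_mul hg p)

theorem extOp_sum {ι : Type*} (S : Finset ι) {f : ι → ℝ × ℝ → ℂ}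
    (hf : ∀ i ∈ S, Integrable (f i)) (p : ℝ × ℝ × ℝ) :
    extOp (fun ξ => ∑ i ∈ S, f i ξ) p = ∑ i ∈ S, extOp (f i) p := by
  simp only [extOp_eq, Finset.mul_sum]
  exact integral_finsetSum S (fun i hi => integrable_ph_mul (hf i hi) p)

theorem integrable_chi {F : Set (ℝ × ℝ)} (hF : MeasurableSet F) (h : volume F ≠ ∞) :
    Integrable (chi F) := by
  unfold chi
  exact (integrable_indicator_iff hF).2 (integrableOn_const h)

theorem measurable_chi {F : Set (ℝ × ℝ)} (hF : MeasurableSet F) : Measurable (chi F) :=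
  measurable_const.indicator hF

theorem norm_chi_le (F : Set (ℝ × ℝ)) (ξ : ℝ × ℝ) : ‖chi F ξ‖ ≤ 1 := by
  unfold chi; by_cases h : ξ ∈ F <;> simp [h]

theorem support_chi (F : Set (ℝ × ℝ)) : Function.support (chi F) = F := by
  unfold chi; ext; simp

/-- A bounded function supported in a set of finite measure is integrable. -/
theorem integrable_of_bdd {f : ℝ × ℝ → ℂ} (hf : Measurable f) (hb : ∀ ξ, ‖f ξ‖ ≤ 1)
    {R : Set (ℝ × ℝ)} (hR : volume R ≠ ∞) (hs : Function.support f ⊆ R) : Integrable f := by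
  rw [← integrableOn_iff_integrable_of_support_subset hs]
  exact Measure.integrableOn_of_bounded hR hf.aestronglyMeasurable
    (Filter.Eventually.of_forall hb)

/-- linear change of variables in `ℝ³` adapted to the rescaling. -/
def lin3 (a b α β : ℝ) (p : ℝ × ℝ × ℝ) : ℝ × ℝ × ℝ :=
  (a * b * p.1, a * (p.2.1 + p.1 * β), b * (p.2.2 + p.1 * α))

/-- The affine change of variables in `ℝ²`. -/
def aff2 (a b α β : ℝ) (θ : ℝ × ℝ) : ℝ × ℝ := (α + a * θ.1, β + b * θ.2)

theorem lintegral_scale (g : ℝ → ℝ≥0∞) (hg : Measurable g) {a : ℝ} (ha : 0 < a) :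
    ∫⁻ x, g (a * x) = ENNReal.ofReal a⁻¹ * ∫⁻ x, g x := by
  have h := Real.map_volume_mul_left ha.ne'
  rw [← lintegral_map (f := g) hg (measurable_const_mul a), h, lintegral_smul_measure,
    abs_of_pos (inv_pos.2 ha), smul_eq_mul]

theorem lintegral_lin3 (G : ℝ × ℝ × ℝ → ℝ≥0∞) (hG : Measurable G) {a b : ℝ} (ha : 0 < a)
    (hb : 0 < b) (α β : ℝ) :
    ∫⁻ p, G (lin3 a b α β p) = ENNReal.ofReal (a * b)⁻¹ ^ 2 * ∫⁻ p, G p := by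
  have hm : Measurable (lin3 a b α β) := by unfold lin3; fun_prop
  rw [Measure.volume_eq_prod, lintegral_prod (fun p => G (lin3 a b α β p)) (hG.comp hm).aemeasurable,
    lintegral_prod _ hG.aemeasurable]
  have h1 : ∀ t : ℝ, ∫⁻ y : ℝ × ℝ, G (lin3 a b α β (t, y)) =
      ENNReal.ofReal (a * b)⁻¹ * ∫⁻ y : ℝ × ℝ, G (a * b * t, y) := by
    intro t
    have hm2 : Measurable (fun y : ℝ × ℝ => G (lin3 a b α β (t, y))) := by fun_prop
    have hm3 : Measurable (fun y : ℝ × ℝ => G (a * b * t, y)) := by fun_prop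
    rw [Measure.volume_eq_prod, lintegral_prod _ hm2.aemeasurable,
      lintegral_prod _ hm3.aemeasurable]
    simp only [lin3]
    have h2 : ∀ x : ℝ, ∫⁻ y : ℝ, G (a * b * t, a * (x + t * β), b * (y + t * α)) =
        ENNReal.ofReal b⁻¹ * ∫⁻ y : ℝ, G (a * b * t, a * (x + t * β), y) := by
      intro x
      rw [lintegral_add_right_eq_self (fun y => G (a * b * t, a * (x + t * β), b * y))]
      exact lintegral_scale (fun y => G (a * b * t, a * (x + t * β), y)) (by fun_prop) hb
    simp_rw [h2]
    have hm4 : Measurable (fun x : ℝ => ∫⁻ y : ℝ, G (a * b * t, x, y)) :=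
      Measurable.lintegral_prod_right' (f := fun q : ℝ × ℝ => G (a * b * t, q.1, q.2))
        (by fun_prop)
    rw [lintegral_const_mul' _ _ ENNReal.ofReal_ne_top,
      lintegral_add_right_eq_self (fun x => ∫⁻ y : ℝ, G (a * b * t, a * x, y)),
      lintegral_scale (fun x => ∫⁻ y : ℝ, G (a * b * t, x, y)) hm4 ha, ← mul_assoc,
      ← ENNReal.ofReal_mul (by positivity), mul_inv, mul_comm b⁻¹]
  simp_rw [h1]
  have hm5 : Measurable (fun t : ℝ => ∫⁻ y : ℝ × ℝ, G (t, y)) := hG.lintegral_prod_right'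
  rw [lintegral_const_mul' _ _ ENNReal.ofReal_ne_top,
    lintegral_scale (fun t => ∫⁻ y : ℝ × ℝ, G (t, y)) hm5 (mul_pos ha hb), ← mul_assoc, sq]

theorem map_aff2 {a b : ℝ} (ha : 0 < a) (hb : 0 < b) (α β : ℝ) :
    Measure.map (aff2 a b α β) volume = ENNReal.ofReal (a * b)⁻¹ • volume := by
  have e : aff2 a b α β = Prod.map (fun x => α + a * x) (fun y => β + b * y) := rfl
  have h1 : ∀ (c : ℝ) (γ : ℝ), 0 < c → Measure.map (fun x => γ + c * x) volume =
      ENNReal.ofReal c⁻¹ • (volume : Measure ℝ) := by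
    intro c γ hc
    have : (fun x => γ + c * x) = (fun x => γ + x) ∘ (fun x => c * x) := rfl
    rw [this, ← Measure.map_map (measurable_const_add γ) (measurable_const_mul c),
      Real.map_volume_mul_left hc.ne', Measure.map_smul, map_add_left_eq_self,
      abs_of_pos (inv_pos.2 hc)]
  rw [e, Measure.volume_eq_prod, ← Measure.map_prod_map _ _ (by fun_prop) (by fun_prop),
    h1 a α ha, h1 b β hb, Measure.prod_smul_left, Measure.prod_smul_right, smul_smul,
    mul_inv, ENNReal.ofReal_mul (by positivity)]

theorem integral_scale2 (g : ℝ × ℝ → ℂ) {a b : ℝ} (ha : 0 < a) (hb : 0 < b) (α β : ℝ) :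
    ∫ θ, g (aff2 a b α β θ) = ((a * b)⁻¹ : ℝ) • ∫ ξ, g ξ := by
  have hemb : MeasurableEmbedding (aff2 a b α β) := by
    have hc : Continuous (aff2 a b α β) := by unfold aff2; fun_prop
    refine hc.measurableEmbedding ?_
    intro x y h
    simp only [aff2, Prod.mk.injEq] at h
    ext
    · have := h.1; exact mul_left_cancel₀ ha.ne' (by linarith)
    · have := h.2; exact mul_left_cancel₀ hb.ne' (by linarith)
  rw [← hemb.integral_map, map_aff2 ha hb, integral_smul_measure, ENNReal.toReal_ofReal (by positivity)]

theorem enorm_extOp_scale (f : ℝ × ℝ → ℂ) {a b : ℝ} (ha : 0 < a) (hb : 0 < b) (α β : ℝ)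
    (p : ℝ × ℝ × ℝ) : extOp f p =
      (a * b : ℝ) * Complex.exp (Complex.I * (p.1 * α * β + p.2.1 * α + p.2.2 * β : ℝ)) *
        extOp (f ∘ aff2 a b α β) (lin3 a b α β p) := by
  have h := integral_scale2 (fun ξ => ph p ξ * f ξ) ha hb α β
  have hab : (a * b) ≠ 0 := by positivity
  have h2 : extOp f p = ((a * b : ℝ) : ℂ) * ∫ θ, ph p (aff2 a b α β θ) * f (aff2 a b α β θ) := by
    rw [h, extOp_eq, Complex.real_smul, ← mul_assoc, ← Complex.ofReal_mul,
      mul_inv_cancel₀ hab]; simp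
  rw [h2, mul_assoc, extOp_eq]
  congr 1
  rw [← integral_const_mul]
  refine integral_congr_ae (Filter.Eventually.of_forall fun θ => ?_)
  beta_reduce
  rw [← mul_assoc]
  congr 1
  simp only [ph, aff2, lin3]
  rw [← Complex.exp_add]
  congr 1
  push_cast
  ring

open MeasureTheory Set
open scoped ENNReal

theorem eLp_eq {α : Type*} [MeasurableSpace α] {μ : Measure α} {s : ℝ} (hs : 0 < s) (h : α → ℂ) :
    eLpNorm h (ENNReal.ofReal s) μ = (∫⁻ x, ‖h x‖ₑ ^ s ∂μ) ^ (1 / s) := by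
  rw [eLpNorm_eq_lintegral_rpow_enorm_toReal (by simpa using hs) ENNReal.ofReal_ne_top,
    ENNReal.toReal_ofReal hs.le]

theorem eLp_scale {s : ℝ} (hs : 0 < s) {a b : ℝ} (ha : 0 < a) (hb : 0 < b) (α β : ℝ)
    {H H' : ℝ × ℝ × ℝ → ℂ} (hH' : Measurable H') (κ : ℝ≥0∞) (hκ : κ ≠ ∞)
    (h : ∀ p, ‖H p‖ₑ = κ * ‖H' (lin3 a b α β p)‖ₑ) :
    eLpNorm H (ENNReal.ofReal s) volume =
      κ * ENNReal.ofReal (a * b) ^ (-(2 / s)) * eLpNorm H' (ENNReal.ofReal s) volume := by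
  have hab : 0 < a * b := mul_pos ha hb
  rw [eLp_eq hs, eLp_eq hs]
  simp_rw [h, ENNReal.mul_rpow_of_nonneg _ _ hs.le]
  rw [lintegral_const_mul' _ _ (ENNReal.rpow_ne_top_of_nonneg hs.le hκ),
    lintegral_lin3 (fun p => ‖H' p‖ₑ ^ s) (by fun_prop) ha hb,
    ENNReal.mul_rpow_of_nonneg _ _ (by positivity),
    ENNReal.mul_rpow_of_nonneg _ _ (by positivity), ← ENNReal.rpow_mul, mul_one_div_cancel hs.ne',
    ENNReal.rpow_one, mul_assoc]
  congr 2
  rw [ENNReal.ofReal_inv_of_pos hab, ← ENNReal.rpow_natCast, ← ENNReal.rpow_mul,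
    ENNReal.inv_rpow, ← ENNReal.rpow_neg]
  congr 1
  push_cast
  ring

theorem volume_unitSq (a b : ℝ) : volume (unitSq a b) = 1 := by
  unfold unitSq
  rw [Measure.volume_eq_prod, Measure.prod_prod]
  simp

theorem measurableSet_unitSq (a b : ℝ) : MeasurableSet (unitSq a b) :=
  measurableSet_Icc.prod measurableSet_Icc

theorem eLpNorm_le_one {f : ℝ × ℝ → ℂ} (hb : ∀ ξ, ‖f ξ‖ ≤ 1) {a b : ℝ}
    (hs : Function.support f ⊆ unitSq a b) (q : ℝ≥0∞) : eLpNorm f q volume ≤ 1 := by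
  have : f = (unitSq a b).indicator f := (indicator_eq_self.2 hs).symm
  rw [this, eLpNorm_indicator_eq_eLpNorm_restrict (measurableSet_unitSq a b)]
  refine (eLpNorm_le_of_ae_bound (C := 1) (Filter.Eventually.of_forall hb)).trans ?_
  simp [volume_unitSq]

theorem BH_bdd {s r A : ℝ} (hBH : BH s r A) {a₁ a₂ b₁ b₂ : ℝ}
    (h1 : 2 ≤ |a₁ - b₁|) (h2 : |a₁ - b₁| ≤ 5) (h3 : 2 ≤ |a₂ - b₂|) (h4 : |a₂ - b₂| ≤ 5)
    {f g : ℝ × ℝ → ℂ} (hf : ∀ ξ, ‖f ξ‖ ≤ 1) (hg : ∀ ξ, ‖g ξ‖ ≤ 1)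
    (hfs : Function.support f ⊆ unitSq a₁ a₂) (hgs : Function.support g ⊆ unitSq b₁ b₂) :
    eLpNorm (fun p => extOp f p * extOp g p) (ENNReal.ofReal s) volume ≤ ENNReal.ofReal A := by
  refine (hBH a₁ a₂ b₁ b₂ h1 h2 h3 h4 f g hfs hgs).trans ?_
  calc _ ≤ ENNReal.ofReal A * 1 * 1 := by
        gcongr
        · exact eLpNorm_le_one hf hfs _
        · exact eLpNorm_le_one hg hgs _
    _ = _ := by simp

theorem eLpNorm_chi_le {r ρ : ℝ} (hρ : r ≤ 0 ∨ ρ ≤ 1 / r) {F : Set (ℝ × ℝ)} 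
    (hF : MeasurableSet F) {a b : ℝ} (hs : F ⊆ unitSq a b) :
    eLpNorm (chi F) (ENNReal.ofReal r) volume ≤ volume F ^ ρ := by
  rcases le_or_gt r 0 with h | h
  · rw [ENNReal.ofReal_of_nonpos h]; simp
  · have h1 : volume F ≤ 1 := (measure_mono hs).trans (volume_unitSq a b).le
    unfold chi
    rw [eLpNorm_indicator_const hF (by simpa using h) ENNReal.ofReal_ne_top,
      ENNReal.toReal_ofReal h.le]
    simp only [enorm_one, one_mul]
    rcases hρ with h' | h'
    · exact absurd h (not_lt.2 h')
    · exact ENNReal.rpow_le_rpow_of_exponent_ge h1 h'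

theorem BH_chi {s r A ρ : ℝ} (hBH : BH s r A) (hρ : r ≤ 0 ∨ ρ ≤ 1 / r) {a₁ a₂ b₁ b₂ : ℝ}
    (h1 : 2 ≤ |a₁ - b₁|) (h2 : |a₁ - b₁| ≤ 5) (h3 : 2 ≤ |a₂ - b₂|) (h4 : |a₂ - b₂| ≤ 5)
    {F G : Set (ℝ × ℝ)} (hF : MeasurableSet F) (hG : MeasurableSet G)
    (hFs : F ⊆ unitSq a₁ a₂) (hGs : G ⊆ unitSq b₁ b₂) :
    eLpNorm (fun p => extOp (chi F) p * extOp (chi G) p) (ENNReal.ofReal s) volume ≤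
      ENNReal.ofReal A * volume F ^ ρ * volume G ^ ρ := by
  refine (hBH a₁ a₂ b₁ b₂ h1 h2 h3 h4 _ _ (by rwa [support_chi]) (by rwa [support_chi])).trans ?_
  gcongr
  · exact eLpNorm_chi_le hρ hF hFs
  · exact eLpNorm_chi_le hρ hG hGs

theorem chi_comp_aff2 (F : Set (ℝ × ℝ)) (a b α β : ℝ) :
    chi F ∘ aff2 a b α β = chi (aff2 a b α β ⁻¹' F) := by
  ext x; simp only [chi, indicator, Function.comp]; rfl

theorem measurable_aff2 (a b α β : ℝ) : Measurable (aff2 a b α β) := by unfold aff2; fun_prop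

theorem volume_preimage_aff2 {a b : ℝ} (ha : 0 < a) (hb : 0 < b) (α β : ℝ) {F : Set (ℝ × ℝ)}
    (hF : MeasurableSet F) :
    volume (aff2 a b α β ⁻¹' F) = ENNReal.ofReal (a * b)⁻¹ * volume F := by
  rw [← Measure.map_apply (measurable_aff2 a b α β) hF, map_aff2 ha hb]; simp

theorem enorm_extOp_scale' (f : ℝ × ℝ → ℂ) {a b : ℝ} (ha : 0 < a) (hb : 0 < b) (α β : ℝ)
    (p : ℝ × ℝ × ℝ) : ‖extOp f p‖ₑ =
      ENNReal.ofReal (a * b) * ‖extOp (f ∘ aff2 a b α β) (lin3 a b α β p)‖ₑ := by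
  rw [enorm_extOp_scale f ha hb α β p, enorm_mul, enorm_mul]
  congr 1
  have : ‖Complex.exp (Complex.I * (p.1 * α * β + p.2.1 * α + p.2.2 * β : ℝ))‖ₑ = 1 := by
    rw [← ofReal_norm, mul_comm, Complex.norm_exp_ofReal_mul_I]; simp
  rw [this, mul_one, ← ofReal_norm, Complex.norm_real, Real.norm_of_nonneg]
  positivity

theorem BH_scaled {s r A ρ : ℝ} (hs : 0 < s) (hBH : BH s r A) (hρ0 : 0 ≤ ρ)
    (hρ : r ≤ 0 ∨ ρ ≤ 1 / r) {a b α β c d : ℝ} (ha : 0 < a) (hb : 0 < b)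
    (h1 : 2 ≤ |c|) (h2 : |c| ≤ 5) (h3 : 2 ≤ |d|) (h4 : |d| ≤ 5)
    {F G : Set (ℝ × ℝ)} (hF : MeasurableSet F) (hG : MeasurableSet G)
    (hFs : ∀ ξ ∈ F, (α ≤ ξ.1 ∧ ξ.1 ≤ α + a) ∧ (β + d * b ≤ ξ.2 ∧ ξ.2 ≤ β + (d + 1) * b))
    (hGs : ∀ ξ ∈ G, (α + c * a ≤ ξ.1 ∧ ξ.1 ≤ α + (c + 1) * a) ∧ (β ≤ ξ.2 ∧ ξ.2 ≤ β + b)) :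
    eLpNorm (fun p => extOp (chi F) p * extOp (chi G) p) (ENNReal.ofReal s) volume ≤
      ENNReal.ofReal A * ENNReal.ofReal (a * b) ^ (2 * (1 - 1 / s) - 2 * ρ) *
        (volume F ^ ρ * volume G ^ ρ) := by
  have hab : 0 < a * b := mul_pos ha hb
  have hF' := measurable_aff2 a b α β hF
  have hG' := measurable_aff2 a b α β hG
  rw [eLp_scale hs ha hb α β
    (H' := fun p => extOp (chi (aff2 a b α β ⁻¹' F)) p * extOp (chi (aff2 a b α β ⁻¹' G)) p)
    ((measurable_extOp (measurable_chi hF')).mul (measurable_extOp (measurable_chi hG')))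
    (ENNReal.ofReal (a * b) * ENNReal.ofReal (a * b)) (by finiteness)]
  · have key := BH_chi (F := aff2 a b α β ⁻¹' F) (G := aff2 a b α β ⁻¹' G) hBH hρ
      (a₁ := 0) (b₁ := c) (a₂ := d) (b₂ := 0) (by simpa using h1) (by simpa using h2)
      (by simpa using h3) (by simpa using h4) hF' hG' ?_ ?_
    · refine (mul_le_mul_right key _).trans (le_of_eq ?_)
      rw [volume_preimage_aff2 ha hb α β hF, volume_preimage_aff2 ha hb α β hG,
        ENNReal.mul_rpow_of_nonneg _ _ hρ0, ENNReal.mul_rpow_of_nonneg _ _ hρ0,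
        ENNReal.ofReal_inv_of_pos hab, ENNReal.inv_rpow, ← ENNReal.rpow_neg]
      set X := ENNReal.ofReal (a * b) with hX
      have hX0 : X ≠ 0 := by simpa [hX] using hab
      have hXt : X ≠ ∞ := ENNReal.ofReal_ne_top
      have e : X ^ (2 * (1 - 1 / s) - 2 * ρ) = X * X * X ^ (-(2 / s)) * X ^ (-ρ) * X ^ (-ρ) := by
        conv_rhs => rw [← ENNReal.rpow_one X]
        simp only [← ENNReal.rpow_mul, ← ENNReal.rpow_add _ _ hX0 hXt]
        congr 1; ring
      rw [e]; ring
    · intro θ hθ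
      have := hFs _ hθ
      simp only [aff2] at this
      obtain ⟨⟨x1, x2⟩, x3, x4⟩ := this
      refine ⟨⟨?_, ?_⟩, ?_, ?_⟩
      · have : 0 ≤ a * θ.1 := by linarith
        exact nonneg_of_mul_nonneg_right this ha
      · exact le_of_mul_le_mul_left (a := a) (by linarith) ha
      · exact le_of_mul_le_mul_left (a := b) (by linarith) hb
      · exact le_of_mul_le_mul_left (a := b) (by linarith) hb
    · intro θ hθ
      have := hGs _ hθ
      simp only [aff2] at this
      obtain ⟨⟨x1, x2⟩, x3, x4⟩ := this
      refine ⟨⟨?_, ?_⟩, ?_, ?_⟩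
      · exact le_of_mul_le_mul_left (a := a) (by linarith) ha
      · exact le_of_mul_le_mul_left (a := a) (by linarith) ha
      · have : 0 ≤ b * θ.2 := by linarith
        exact nonneg_of_mul_nonneg_right this hb
      · exact le_of_mul_le_mul_left (a := b) (by linarith) hb
  · intro p
    rw [enorm_mul, enorm_mul, enorm_extOp_scale' (chi F) ha hb α β,
      enorm_extOp_scale' (chi G) ha hb α β, chi_comp_aff2, chi_comp_aff2]
    ring

open MeasureTheory Set
open scoped ENNReal

theorem tsum_jensen {ι : Type*} (w y : ι → ℝ≥0∞) {s : ℝ} (hs : 1 ≤ s) :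
    (∑' i, w i * y i) ^ s ≤ (∑' i, w i) ^ (s - 1) * ∑' i, w i * y i ^ s := by
  let _ : MeasurableSpace ι := ⊤
  have hs0 : 0 < s := by linarith
  have h1s : 1 / s ≤ 1 := by rw [div_le_one hs0]; exact hs
  have h := ENNReal.lintegral_mul_norm_pow_le (μ := Measure.count) (f := fun i => w i * y i ^ s)
    (g := w) (measurable_from_top).aemeasurable (measurable_from_top).aemeasurable
    (p := 1 / s) (q := 1 - 1 / s) (by positivity) (by linarith) (by ring)
  have e : ∀ i, (w i * y i ^ s) ^ (1 / s) * w i ^ (1 - 1 / s) = w i * y i := by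
    intro i
    rw [ENNReal.mul_rpow_of_nonneg _ _ (by positivity), ← ENNReal.rpow_mul,
      mul_one_div_cancel hs0.ne', ENNReal.rpow_one, mul_right_comm,
      ← ENNReal.rpow_add_of_nonneg _ _ (by positivity) (by linarith)]
    simp
  simp_rw [e] at h
  rw [lintegral_count' measurable_from_top, lintegral_count' measurable_from_top,
    lintegral_count' measurable_from_top] at h
  refine (ENNReal.rpow_le_rpow h hs0.le).trans (le_of_eq ?_)
  rw [ENNReal.mul_rpow_of_nonneg _ _ hs0.le, ← ENNReal.rpow_mul, ← ENNReal.rpow_mul,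
    one_div_mul_cancel hs0.ne', ENNReal.rpow_one, mul_comm]
  congr 2
  field_simp

theorem lintegral_jensen {ι α : Type*} [Countable ι] [MeasurableSpace α] (μ : Measure α)
    (w : ι → ℝ≥0∞) (Y : ι → α → ℝ≥0∞) {s : ℝ} (hs : 1 ≤ s) (hY : ∀ i, AEMeasurable (Y i) μ)
    (B : ℝ≥0∞) (hB : ∀ i, ∫⁻ x, Y i x ^ s ∂μ ≤ B) (hW : ∑' i, w i ≠ ∞) :
    ∫⁻ x, (∑' i, w i * Y i x) ^ s ∂μ ≤ (∑' i, w i) ^ s * B := by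
  set W := ∑' i, w i with hWdef
  have hs1 : 0 ≤ s - 1 := by linarith
  have hw : ∀ i, w i ≠ ∞ := fun i => ne_top_of_le_ne_top hW (ENNReal.le_tsum i)
  calc ∫⁻ x, (∑' i, w i * Y i x) ^ s ∂μ
      ≤ ∫⁻ x, W ^ (s - 1) * ∑' i, w i * Y i x ^ s ∂μ :=
        lintegral_mono fun x => tsum_jensen w (fun i => Y i x) hs
    _ = W ^ (s - 1) * ∑' i, w i * ∫⁻ x, Y i x ^ s ∂μ := by
        rw [lintegral_const_mul' _ _ (ENNReal.rpow_ne_top_of_nonneg hs1 hW),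
          lintegral_tsum (fun i => ((hY i).pow_const s).const_mul (w i))]
        congr 2
        ext i
        rw [lintegral_const_mul' _ _ (hw i)]
    _ ≤ W ^ (s - 1) * ∑' i, w i * B := by
        gcongr with i
        exact hB i
    _ = W ^ s * B := by
        rw [ENNReal.tsum_mul_right, ← mul_assoc]
        congr 1
        conv_lhs => rw [← hWdef]; rhs; rw [← ENNReal.rpow_one W]
        rw [← ENNReal.rpow_add_of_nonneg _ _ hs1 zero_le_one]
        congr 1; ring

/-- `(∑ |z|²)^{s/2} ≤ ∑ |z|^s`. -/
theorem sum_sq_rpow_le {ι : Type*} (S : Finset ι) (z : ι → ℝ≥0∞) {s : ℝ} (hs0 : 0 < s)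
    (hs : s ≤ 2) : (∑ i ∈ S, z i ^ (2 : ℝ)) ^ (s / 2) ≤ ∑ i ∈ S, z i ^ s := by
  classical
  induction S using Finset.induction_on with
  | empty => simp [hs0]
  | insert a S ha ih =>
    rw [Finset.sum_insert ha, Finset.sum_insert ha]
    refine (ENNReal.rpow_add_le_add_rpow _ _ (by positivity) (by linarith)).trans ?_
    rw [← ENNReal.rpow_mul]
    have : 2 * (s / 2) = s := by ring
    rw [this]
    gcongr

/-- The measure on the averaging parameter. -/
noncomputable def nu : Measure (ℝ × ℝ) :=
  (volume.restrict (Ioc 0 (2 * Real.pi))).prod (volume.restrict (Ioc 0 (2 * Real.pi)))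

instance : IsFiniteMeasure nu := by unfold nu; infer_instance

theorem nu_univ : nu univ = ENNReal.ofReal (2 * Real.pi) * ENNReal.ofReal (2 * Real.pi) := by
  unfold nu
  rw [← univ_prod_univ, Measure.prod_prod]; simp

/-- The characters. -/
noncomputable def ee (k : ℤ × ℤ) (u : ℝ × ℝ) : ℂ :=
  Complex.exp (Complex.I * (2 * (k.1 * u.1 + k.2 * u.2) : ℝ))

theorem continuous_ee (k : ℤ × ℤ) : Continuous (ee k) := by unfold ee; fun_prop

theorem norm_ee (k : ℤ × ℤ) (u : ℝ × ℝ) : ‖ee k u‖ = 1 := by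
  unfold ee; rw [mul_comm]; exact Complex.norm_exp_ofReal_mul_I _

theorem ee_mul_conj (k l : ℤ × ℤ) (u : ℝ × ℝ) :
    ee k u * (starRingEnd ℂ) (ee l u) = ee (k - l) u := by
  unfold ee
  rw [← Complex.exp_conj, ← Complex.exp_add]
  congr 1
  rw [map_mul, Complex.conj_I, Complex.conj_ofReal, Prod.fst_sub, Prod.snd_sub]
  push_cast
  ring

theorem integral_exp1 (n : ℤ) (hn : n ≠ 0) :
    ∫ u in Ioc 0 (2 * Real.pi), Complex.exp (Complex.I * (2 * (n * u) : ℝ)) = 0 := by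
  rw [← intervalIntegral.integral_of_le (by positivity)]
  have : ∀ u : ℝ, Complex.exp (Complex.I * (2 * (n * u) : ℝ)) =
      Complex.exp ((Complex.I * 2 * n) * u) := by
    intro u; congr 1; push_cast; ring
  simp_rw [this]
  have hn' : (Complex.I * 2 * n) ≠ 0 := by simp [hn]
  rw [integral_exp_mul_complex hn']
  have : Complex.exp (Complex.I * 2 * n * (2 * Real.pi : ℝ)) = 1 := by
    rw [Complex.exp_eq_one_iff]
    exact ⟨2 * n, by push_cast; ring⟩
  rw [this]; simp

theorem integral_ee (k : ℤ × ℤ) : ∫ u, ee k u ∂nu = if k = 0 then (nu.real univ : ℂ) else 0 := by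
  split_ifs with h
  · subst h
    simp [ee]
  · have : ∀ u : ℝ × ℝ, ee k u = Complex.exp (Complex.I * (2 * (k.1 * u.1) : ℝ)) *
        Complex.exp (Complex.I * (2 * (k.2 * u.2) : ℝ)) := by
      intro u; unfold ee; rw [← Complex.exp_add]; congr 1; push_cast; ring
    simp_rw [this]
    unfold nu
    rw [integral_prod_mul (fun x : ℝ => Complex.exp (Complex.I * (2 * (k.1 * x) : ℝ)))
      (fun x : ℝ => Complex.exp (Complex.I * (2 * (k.2 * x) : ℝ)))]
    by_cases h1 : k.1 = 0
    · have h2 : k.2 ≠ 0 := fun h2 => h (Prod.ext h1 h2)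
      rw [integral_exp1 _ h2, mul_zero]
    · rw [integral_exp1 _ h1, zero_mul]

theorem bessel (S : Finset (ℤ × ℤ)) (z : ℤ × ℤ → ℂ) :
    ∫⁻ u, ‖∑ k ∈ S, ee k u * z k‖ₑ ^ (2 : ℝ) ∂nu = nu univ * ∑ k ∈ S, ‖z k‖ₑ ^ (2 : ℝ) := by
  have hcont : Continuous (fun u => ∑ k ∈ S, ee k u * z k) :=
    continuous_finsetSum _ fun k _ => (continuous_ee k).mul continuous_const
  have hbd : ∀ u, ‖∑ k ∈ S, ee k u * z k‖ ≤ ∑ k ∈ S, ‖z k‖ := fun u =>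
    (norm_sum_le _ _).trans (le_of_eq (Finset.sum_congr rfl fun k _ => by
      rw [norm_mul, norm_ee, one_mul]))
  have hInteg : Integrable (fun u => ‖∑ k ∈ S, ee k u * z k‖ ^ 2) nu := by
    refine Integrable.of_bound (hcont.norm.pow 2).aestronglyMeasurable ((∑ k ∈ S, ‖z k‖) ^ 2)
      (Filter.Eventually.of_forall fun u => ?_)
    rw [Real.norm_of_nonneg (by positivity)]
    gcongr
    exact hbd u
  have hreal : ∫ u, ‖∑ k ∈ S, ee k u * z k‖ ^ 2 ∂nu = nu.real univ * ∑ k ∈ S, ‖z k‖ ^ 2 := by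
    have h1 : ∀ u, ((‖∑ k ∈ S, ee k u * z k‖ ^ 2 : ℝ) : ℂ) =
        ∑ k ∈ S, ∑ l ∈ S, ee (k - l) u * (z k * (starRingEnd ℂ) (z l)) := by
      intro u
      push_cast
      rw [← Complex.mul_conj', map_sum, Finset.sum_mul_sum]
      refine Finset.sum_congr rfl fun k _ => Finset.sum_congr rfl fun l _ => ?_
      rw [← ee_mul_conj, map_mul]; ring
    have hi : ∀ k l : ℤ × ℤ, Integrable
        (fun u => ee (k - l) u * (z k * (starRingEnd ℂ) (z l))) nu := fun k l =>
      Integrable.of_bound ((continuous_ee _).mul continuous_const).aestronglyMeasurable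
        ‖z k * (starRingEnd ℂ) (z l)‖ (Filter.Eventually.of_forall fun u => by
          rw [norm_mul, norm_ee, one_mul])
    have h2 : ((∫ u, ‖∑ k ∈ S, ee k u * z k‖ ^ 2 ∂nu : ℝ) : ℂ) =
        ((nu.real univ * ∑ k ∈ S, ‖z k‖ ^ 2 : ℝ) : ℂ) := by
      rw [← integral_complex_ofReal]
      simp_rw [h1]
      rw [integral_finsetSum _ fun k _ => integrable_finsetSum _ fun l _ => hi k l]
      push_cast
      rw [Finset.mul_sum]
      refine Finset.sum_congr rfl fun k hk => ?_
      rw [integral_finsetSum _ fun l _ => hi k l]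
      simp_rw [integral_mul_const, integral_ee, sub_eq_zero]
      simp only [ite_mul, zero_mul]
      rw [Finset.sum_ite_eq, if_pos hk, Complex.mul_conj']
    exact_mod_cast h2
  have e : ∀ x : ℂ, ‖x‖ₑ ^ (2 : ℝ) = ENNReal.ofReal (‖x‖ ^ 2) := by
    intro x
    rw [ENNReal.ofReal_pow (norm_nonneg _), ofReal_norm]
    exact_mod_cast ENNReal.rpow_natCast _ 2
  simp_rw [e]
  rw [← ofReal_integral_eq_lintegral_ofReal hInteg (Filter.Eventually.of_forall fun u => by positivity),
    hreal, ENNReal.ofReal_mul (by positivity), ENNReal.ofReal_sum_of_nonneg fun i _ => by positivity]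
  congr 1
  simp [measureReal_def]

theorem bessel_s (S : Finset (ℤ × ℤ)) (z : ℤ × ℤ → ℂ) {s : ℝ} (hs0 : 0 < s) (hs : s < 2) :
    ∫⁻ u, ‖∑ k ∈ S, ee k u * z k‖ₑ ^ s ∂nu ≤ nu univ * ∑ k ∈ S, ‖z k‖ₑ ^ s := by
  have hcont : Continuous (fun u => ∑ k ∈ S, ee k u * z k) :=
    continuous_finsetSum _ fun k _ => (continuous_ee k).mul continuous_const
  have h := ENNReal.lintegral_mul_norm_pow_le (μ := nu)
    (f := fun u => ‖∑ k ∈ S, ee k u * z k‖ₑ ^ (2 : ℝ)) (g := fun _ => 1)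
    (hcont.enorm.measurable.pow_const _).aemeasurable aemeasurable_const
    (p := s / 2) (q := 1 - s / 2) (by positivity) (by linarith) (by ring)
  simp only [ENNReal.one_rpow, mul_one, ← ENNReal.rpow_mul, bessel, lintegral_const, one_mul] at h
  have e : 2 * (s / 2) = s := by ring
  rw [e, ENNReal.mul_rpow_of_nonneg _ _ (by positivity)] at h
  refine h.trans ?_
  rw [mul_right_comm, ← ENNReal.rpow_add_of_nonneg _ _ (by positivity) (by linarith)]
  have e2 : s / 2 + (1 - s / 2) = 1 := by ring
  rw [e2, ENNReal.rpow_one]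
  gcongr
  exact sum_sq_rpow_le S _ hs0 hs.le

open MeasureTheory Set
open scoped ENNReal

/-- Multiplication of `f` by a monomial centred at `(m, n)`. -/
noncomputable def twist (f : ℝ × ℝ → ℂ) (m n : ℝ) (a : ℕ × ℕ) (ξ : ℝ × ℝ) : ℂ :=
  (((ξ.1 - m) ^ a.1 * (ξ.2 - n) ^ a.2 : ℝ) : ℂ) * f ξ

theorem measurable_twist {f : ℝ × ℝ → ℂ} (hf : Measurable f) (m n : ℝ) (a : ℕ × ℕ) :
    Measurable (twist f m n a) := by
  unfold twist; fun_prop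

theorem support_twist {f : ℝ × ℝ → ℂ} (m n : ℝ) (a : ℕ × ℕ) {R : Set (ℝ × ℝ)}
    (hs : Function.support f ⊆ R) : Function.support (twist f m n a) ⊆ R := by
  refine subset_trans ?_ hs
  intro ξ hξ h
  exact hξ (by simp [twist, h])

theorem norm_twist_le {f : ℝ × ℝ → ℂ} {m n : ℝ} (a : ℕ × ℕ)
    (hs : Function.support f ⊆ unitSq m n) (ξ : ℝ × ℝ) : ‖twist f m n a ξ‖ ≤ ‖f ξ‖ := by
  by_cases h : f ξ = 0
  · simp [twist, h]
  · have hξ : ξ ∈ unitSq m n := hs h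
    obtain ⟨⟨h1, h2⟩, h3, h4⟩ := hξ
    unfold twist
    rw [norm_mul, Complex.norm_real, norm_mul, norm_pow, norm_pow]
    have e1 : ‖ξ.1 - m‖ ≤ 1 := by rw [Real.norm_of_nonneg (by linarith)]; linarith
    have e2 : ‖ξ.2 - n‖ ≤ 1 := by rw [Real.norm_of_nonneg (by linarith)]; linarith
    have := mul_le_one₀ (pow_le_one₀ (n := a.1) (norm_nonneg _) e1) (by positivity)
      (pow_le_one₀ (n := a.2) (norm_nonneg _) e2)
    exact mul_le_of_le_one_left (norm_nonneg _) this

/-- Taylor coefficients of the shift. -/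
noncomputable def kap (u : ℝ × ℝ) (a : ℕ × ℕ) : ℂ :=
  (Complex.I * u.1) ^ a.1 / (a.1.factorial : ℂ) * ((Complex.I * u.2) ^ a.2 / (a.2.factorial : ℂ))

theorem hasSum_exp (z : ℂ) : HasSum (fun n : ℕ => z ^ n / (n.factorial : ℂ)) (Complex.exp z) := by
  rw [Complex.exp_eq_exp_ℂ]
  exact NormedSpace.expSeries_div_hasSum_exp z

theorem summable_norm_exp (z : ℂ) : Summable (fun n : ℕ => ‖z ^ n / (n.factorial : ℂ)‖) :=
  NormedSpace.norm_expSeries_div_summable z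

theorem summable_norm_mul2 {ι κ : Type} {F : ι → ℂ} {G : κ → ℂ}
    (nF : Summable fun n => ‖F n‖) (nG : Summable fun n => ‖G n‖) :
    Summable (fun a : ι × κ => ‖F a.1 * G a.2‖) := nF.mul_norm nG

theorem hasSum_mul2 {ι κ : Type} {F : ι → ℂ} {G : κ → ℂ} {x y : ℂ}
    (hF : HasSum F x) (hG : HasSum G y)
    (nF : Summable fun n => ‖F n‖) (nG : Summable fun n => ‖G n‖) :
    HasSum (fun a : ι × κ => F a.1 * G a.2) (x * y) :=
  hF.mul hG (summable_mul_of_summable_norm nF nG)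

theorem summable_norm_kap (u : ℝ × ℝ) : Summable (fun a => ‖kap u a‖) := by
  have h := summable_norm_mul2 (summable_norm_exp (Complex.I * u.1))
    (summable_norm_exp (Complex.I * u.2))
  unfold kap
  exact h

theorem hasSum_exp2 (z w : ℂ) : HasSum (fun a : ℕ × ℕ => z ^ a.1 / (a.1.factorial : ℂ) *
    (w ^ a.2 / (a.2.factorial : ℂ))) (Complex.exp z * Complex.exp w) := by
  have h := hasSum_mul2 (hasSum_exp z) (hasSum_exp w) (summable_norm_exp z) (summable_norm_exp w)
  exact h

theorem norm_extOp_le (f : ℝ × ℝ → ℂ) (p : ℝ × ℝ × ℝ) : ‖extOp f p‖ ≤ ∫ ξ, ‖f ξ‖ := by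
  rw [extOp_eq]
  refine (norm_integral_le_integral_norm _).trans (le_of_eq ?_)
  simp_rw [norm_mul, norm_ph, one_mul]

theorem hasSum_shift {f : ℝ × ℝ → ℂ} (hf : Measurable f) (hfi : Integrable f) {m n : ℝ}
    (hs : Function.support f ⊆ unitSq m n) (p : ℝ × ℝ × ℝ) (u : ℝ × ℝ) :
    HasSum (fun a => kap u a * extOp (twist f m n a) p)
      (Complex.exp (-(Complex.I * (m * u.1 + n * u.2 : ℝ))) * extOp f (p + (0, u))) := by
  have hti : ∀ a, Integrable (twist f m n a) := fun a =>
    hfi.mono (measurable_twist hf m n a).aestronglyMeasurable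
      (Filter.Eventually.of_forall (norm_twist_le a hs))
  have h := hasSum_integral_of_summable_integral_norm (μ := (volume : Measure (ℝ × ℝ)))
    (F := fun (a : ℕ × ℕ) ξ => kap u a * (ph p ξ * twist f m n a ξ))
    (fun a => (integrable_ph_mul (hti a) p).const_mul _) ?_
  · simp_rw [integral_const_mul] at h
    suffices hv : Complex.exp (-(Complex.I * (m * u.1 + n * u.2 : ℝ))) * extOp f (p + (0, u)) =
        ∫ ξ, ∑' a, kap u a * (ph p ξ * twist f m n a ξ) by
      rw [hv]
      simp only [extOp_eq]
      exact h
    rw [extOp_eq, ← integral_const_mul]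
    refine integral_congr_ae (Filter.Eventually.of_forall fun ξ => ?_)
    beta_reduce
    have e := ((hasSum_exp2 (Complex.I * u.1 * (ξ.1 - m : ℝ))
      (Complex.I * u.2 * (ξ.2 - n : ℝ))).mul_right (ph p ξ * f ξ)).tsum_eq
    have e2 : ∀ a : ℕ × ℕ, kap u a * (ph p ξ * twist f m n a ξ) =
        (Complex.I * u.1 * (ξ.1 - m : ℝ)) ^ a.1 / (a.1.factorial : ℂ) *
          ((Complex.I * u.2 * (ξ.2 - n : ℝ)) ^ a.2 / (a.2.factorial : ℂ)) * (ph p ξ * f ξ) := by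
      intro a
      unfold kap twist
      push_cast
      rw [mul_pow (Complex.I * (u.1 : ℂ)), mul_pow (Complex.I * (u.2 : ℂ))]
      ring
    simp_rw [e2]
    rw [e, ← mul_assoc, ← mul_assoc]
    congr 1
    unfold ph
    rw [← Complex.exp_add, ← Complex.exp_add, ← Complex.exp_add]
    congr 1
    simp only [Prod.fst_add, Prod.snd_add]
    push_cast
    ring
  · refine Summable.of_nonneg_of_le (fun a => by positivity) (fun a => ?_)
      ((summable_norm_kap u).mul_right (∫ ξ, ‖f ξ‖))
    simp_rw [norm_mul, norm_ph, one_mul]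
    rw [integral_const_mul]
    gcongr
    · exact (hti a).norm
    · exact hfi.norm
    · exact fun ξ => norm_twist_le a hs ξ

/-- Weights for the Taylor expansion. -/
noncomputable def wt (a : ℕ × ℕ) : ℝ :=
  (2 * Real.pi) ^ a.1 / (a.1.factorial : ℝ) * ((2 * Real.pi) ^ a.2 / (a.2.factorial : ℝ))

theorem wt_nonneg (a : ℕ × ℕ) : 0 ≤ wt a := by unfold wt; positivity

theorem summable_wt : Summable wt := by
  unfold wt
  exact (Real.summable_pow_div_factorial (2 * Real.pi)).mul_of_nonneg
    (Real.summable_pow_div_factorial (2 * Real.pi)) (fun _ => by positivity) (fun _ => by positivity)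

theorem norm_kap_le {u : ℝ × ℝ} (h1 : u.1 ∈ Ioc 0 (2 * Real.pi)) (h2 : u.2 ∈ Ioc 0 (2 * Real.pi))
    (a : ℕ × ℕ) : ‖kap u a‖ ≤ wt a := by
  unfold kap wt
  simp only [norm_mul, norm_div, norm_pow, Complex.norm_I, one_mul, Complex.norm_real,
    Complex.norm_natCast, Real.norm_eq_abs, abs_of_pos h1.1, abs_of_pos h2.1]
  have := h1.2
  have := h2.2
  have := h1.1.le
  have := h2.1.le
  gcongr

theorem ae_nu : ∀ᵐ u ∂nu, u.1 ∈ Ioc 0 (2 * Real.pi) ∧ u.2 ∈ Ioc 0 (2 * Real.pi) := by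
  unfold nu
  rw [Measure.prod_restrict]
  filter_upwards [ae_restrict_mem (measurableSet_Ioc.prod measurableSet_Ioc)] with u hu
  exact hu

theorem pointwise_shift (S : Finset (ℤ × ℤ)) {c d : ℝ} {f g : ℤ × ℤ → ℝ × ℝ → ℂ}
    (hf : ∀ k, Measurable (f k)) (hfi : ∀ k, Integrable (f k))
    (hg : ∀ k, Measurable (g k)) (hgi : ∀ k, Integrable (g k))
    (hfs : ∀ k : ℤ × ℤ, Function.support (f k) ⊆ unitSq k.1 k.2)
    (hgs : ∀ k : ℤ × ℤ, Function.support (g k) ⊆ unitSq (k.1 + c) (k.2 + d))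
    (p : ℝ × ℝ × ℝ) {u : ℝ × ℝ}
    (h1 : u.1 ∈ Ioc 0 (2 * Real.pi)) (h2 : u.2 ∈ Ioc 0 (2 * Real.pi)) :
    ‖∑ k ∈ S, extOp (f k) (p + (0, u)) * extOp (g k) (p + (0, u))‖ₑ ≤
      ∑' ab : (ℕ × ℕ) × (ℕ × ℕ), ENNReal.ofReal (wt ab.1 * wt ab.2) *
        ‖∑ k ∈ S, ee k u * (extOp (twist (f k) k.1 k.2 ab.1) p *
          extOp (twist (g k) (k.1 + c) (k.2 + d) ab.2) p)‖ₑ := by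
  have hsn : ∀ (h : ℝ × ℝ → ℂ) (_ : Measurable h) (_ : Integrable h) (m n : ℝ)
      (_ : Function.support h ⊆ unitSq m n),
      Summable (fun a => ‖kap u a * extOp (twist h m n a) p‖) := by
    intro h hm hi m n hs
    refine Summable.of_nonneg_of_le (fun a => by positivity) (fun a => ?_)
      ((summable_norm_kap u).mul_right (∫ ξ, ‖h ξ‖))
    rw [norm_mul]
    gcongr
    refine (norm_extOp_le _ _).trans (integral_mono ?_ hi.norm (norm_twist_le a hs))
    exact (hi.mono (measurable_twist hm m n a).aestronglyMeasurable
      (Filter.Eventually.of_forall (norm_twist_le a hs))).norm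
  have hk : ∀ k : ℤ × ℤ, HasSum (fun ab : (ℕ × ℕ) × (ℕ × ℕ) =>
      ee k u * ((kap u ab.1 * extOp (twist (f k) k.1 k.2 ab.1) p) *
        (kap u ab.2 * extOp (twist (g k) (k.1 + c) (k.2 + d) ab.2) p)))
      (Complex.exp (-(Complex.I * (c * u.1 + d * u.2 : ℝ))) *
        (extOp (f k) (p + (0, u)) * extOp (g k) (p + (0, u)))) := by
    intro k
    have e : Complex.exp (-(Complex.I * (c * u.1 + d * u.2 : ℝ))) = ee k u *
        (Complex.exp (-(Complex.I * (k.1 * u.1 + k.2 * u.2 : ℝ))) *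
          Complex.exp (-(Complex.I * ((k.1 + c) * u.1 + (k.2 + d) * u.2 : ℝ)))) := by
      unfold ee
      rw [← Complex.exp_add, ← Complex.exp_add]
      congr 1
      push_cast
      ring
    have h := (hasSum_mul2 (hasSum_shift (hf k) (hfi k) (hfs k) p u)
      (hasSum_shift (hg k) (hgi k) (hgs k) p u) (hsn _ (hf k) (hfi k) _ _ (hfs k))
        (hsn _ (hg k) (hgi k) _ _ (hgs k))).mul_left (ee k u)
    have e3 : ∀ a b x y z : ℂ, a * (b * x * (z * y)) = a * (b * z) * (x * y) := by
      intros; ring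
    rw [e3, ← e] at h
    exact h
  have hsum := hasSum_sum (s := S) (fun k _ => hk k)
  have hn : ‖∑ k ∈ S, extOp (f k) (p + (0, u)) * extOp (g k) (p + (0, u))‖ₑ =
      ‖∑ k ∈ S, Complex.exp (-(Complex.I * (c * u.1 + d * u.2 : ℝ))) *
        (extOp (f k) (p + (0, u)) * extOp (g k) (p + (0, u)))‖ₑ := by
    rw [← Finset.mul_sum, enorm_mul]
    have : ‖Complex.exp (-(Complex.I * (c * u.1 + d * u.2 : ℝ)))‖ₑ = 1 := by
      rw [← ofReal_norm, ← mul_neg, mul_comm, ← Complex.ofReal_neg, Complex.norm_exp_ofReal_mul_I]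
      simp
    rw [this, one_mul]
  rw [hn, ← hsum.tsum_eq]
  refine enorm_tsum_le_tsum_enorm.trans (ENNReal.tsum_le_tsum fun ab => ?_)
  have e : ∑ k ∈ S, ee k u * ((kap u ab.1 * extOp (twist (f k) k.1 k.2 ab.1) p) *
        (kap u ab.2 * extOp (twist (g k) (k.1 + c) (k.2 + d) ab.2) p)) =
      kap u ab.1 * kap u ab.2 * ∑ k ∈ S, ee k u * (extOp (twist (f k) k.1 k.2 ab.1) p *
          extOp (twist (g k) (k.1 + c) (k.2 + d) ab.2) p) := by
    rw [Finset.mul_sum]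
    refine Finset.sum_congr rfl fun k _ => ?_
    ring
  rw [e, enorm_mul]
  gcongr
  rw [← ofReal_norm, norm_mul]
  apply ENNReal.ofReal_le_ofReal
  have := wt_nonneg ab.1
  gcongr
  · exact norm_kap_le h1 h2 _
  · exact norm_kap_le h1 h2 _

/-- The constant from the Taylor expansion. -/
noncomputable def WW : ℝ≥0∞ := ∑' ab : (ℕ × ℕ) × (ℕ × ℕ), ENNReal.ofReal (wt ab.1 * wt ab.2)

theorem WW_ne_top : WW ≠ ∞ := by
  unfold WW
  have : Summable (fun ab : (ℕ × ℕ) × (ℕ × ℕ) => wt ab.1 * wt ab.2) :=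
    summable_wt.mul_of_nonneg summable_wt wt_nonneg wt_nonneg
  exact this.tsum_ofReal_ne_top

/-- Almost orthogonality at unit scale. -/
theorem orth {s r A : ℝ} (hs1 : 1 ≤ s) (hs2 : s < 2) (hBH : BH s r A)
    (S : Finset (ℤ × ℤ)) {c d : ℝ} (hc1 : 2 ≤ |c|) (hc2 : |c| ≤ 5) (hd1 : 2 ≤ |d|) (hd2 : |d| ≤ 5)
    {f g : ℤ × ℤ → ℝ × ℝ → ℂ}
    (hf : ∀ k, Measurable (f k)) (hfb : ∀ k ξ, ‖f k ξ‖ ≤ 1)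
    (hg : ∀ k, Measurable (g k)) (hgb : ∀ k ξ, ‖g k ξ‖ ≤ 1)
    (hfs : ∀ k : ℤ × ℤ, Function.support (f k) ⊆ unitSq k.1 k.2)
    (hgs : ∀ k : ℤ × ℤ, Function.support (g k) ⊆ unitSq (k.1 + c) (k.2 + d)) :
    ∫⁻ p, ‖∑ k ∈ S, extOp (f k) p * extOp (g k) p‖ₑ ^ s ≤
      WW ^ s * (S.card * ENNReal.ofReal A ^ s) := by
  have hs0 : 0 < s := by linarith
  have hfi : ∀ k, Integrable (f k) := fun k => integrable_of_bdd (hf k) (hfb k)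
    (by rw [volume_unitSq]; simp) (hfs k)
  have hgi : ∀ k, Integrable (g k) := fun k => integrable_of_bdd (hg k) (hgb k)
    (by rw [volume_unitSq]; simp) (hgs k)
  set H : ℝ × ℝ × ℝ → ℝ≥0∞ := fun p => ‖∑ k ∈ S, extOp (f k) p * extOp (g k) p‖ₑ ^ s with hH
  have hHm : Measurable H := by
    refine Measurable.pow_const (Measurable.enorm ?_) s
    exact Finset.measurable_fun_sum _ fun k _ =>
      (measurable_extOp (hf k)).mul (measurable_extOp (hg k))
  have hν0 : nu univ ≠ 0 := by rw [nu_univ]; simp [Real.pi_pos]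
  have hνt : nu univ ≠ ∞ := measure_ne_top _ _
  have hleft : ∫⁻ q : (ℝ × ℝ × ℝ) × (ℝ × ℝ), H (q.1 + (0, q.2)) ∂(volume.prod nu) =
      nu univ * ∫⁻ p, H p := by
    rw [lintegral_prod_symm _ (by fun_prop)]
    have inst : (volume : Measure (ℝ × ℝ × ℝ)).IsAddLeftInvariant :=
      Measure.prod.instIsAddLeftInvariant (μ := (volume : Measure ℝ))
        (ν := (volume : Measure (ℝ × ℝ)))
    have hh : ∀ u : ℝ × ℝ, ∫⁻ p : ℝ × ℝ × ℝ, H (p + (0, u)) = ∫⁻ p, H p := by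
      intro u
      simp_rw [add_comm _ ((0 : ℝ), u)]
      exact lintegral_add_left_eq_self H _
    rw [lintegral_congr hh]
    rw [lintegral_const, mul_comm]
  set Y : (ℕ × ℕ) × (ℕ × ℕ) → (ℝ × ℝ × ℝ) × (ℝ × ℝ) → ℝ≥0∞ := fun ab q =>
    ‖∑ k ∈ S, ee k q.2 * (extOp (twist (f k) k.1 k.2 ab.1) q.1 *
          extOp (twist (g k) (k.1 + c) (k.2 + d) ab.2) q.1)‖ₑ with hY
  have hYm : ∀ ab, Measurable (Y ab) := by
    intro ab
    refine Measurable.enorm ?_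
    refine Finset.measurable_fun_sum _ fun k _ => ?_
    exact ((continuous_ee k).measurable.comp measurable_snd).mul
      (((measurable_extOp (measurable_twist (hf k) _ _ _)).comp measurable_fst).mul
      ((measurable_extOp (measurable_twist (hg k) _ _ _)).comp measurable_fst))
  have hright : ∀ ab, ∫⁻ q, Y ab q ^ s ∂(volume.prod nu) ≤
      nu univ * (S.card * ENNReal.ofReal A ^ s) := by
    intro ab
    rw [lintegral_prod _ ((hYm ab).pow_const s).aemeasurable]
    calc _ ≤ ∫⁻ p : ℝ × ℝ × ℝ, nu univ * ∑ k ∈ S, ‖extOp (twist (f k) k.1 k.2 ab.1) p *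
            extOp (twist (g k) (k.1 + c) (k.2 + d) ab.2) p‖ₑ ^ s :=
          lintegral_mono fun p => bessel_s S _ hs0 hs2
      _ = nu univ * ∑ k ∈ S, ∫⁻ p : ℝ × ℝ × ℝ, ‖extOp (twist (f k) k.1 k.2 ab.1) p *
            extOp (twist (g k) (k.1 + c) (k.2 + d) ab.2) p‖ₑ ^ s := by
          rw [lintegral_const_mul' _ _ hνt, lintegral_finsetSum]
          intro k _
          exact ((measurable_extOp (measurable_twist (hf k) _ _ _)).mul
            (measurable_extOp (measurable_twist (hg k) _ _ _))).enorm.pow_const s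
      _ ≤ nu univ * ∑ k ∈ S, ENNReal.ofReal A ^ s := by
          gcongr with k hk
          have := BH_bdd hBH (a₁ := k.1) (a₂ := k.2) (b₁ := k.1 + c) (b₂ := k.2 + d)
            (by simpa using hc1) (by simpa using hc2) (by simpa using hd1) (by simpa using hd2)
            (fun ξ => (norm_twist_le ab.1 (hfs k) ξ).trans (hfb k ξ))
            (fun ξ => (norm_twist_le ab.2 (hgs k) ξ).trans (hgb k ξ))
            (support_twist _ _ _ (hfs k)) (support_twist _ _ _ (hgs k))
          rw [eLp_eq hs0] at this
          have h2 := ENNReal.rpow_le_rpow this hs0.le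
          rwa [← ENNReal.rpow_mul, one_div_mul_cancel hs0.ne', ENNReal.rpow_one] at h2
      _ = _ := by simp
  have hmain := lintegral_jensen (volume.prod nu) (fun ab : (ℕ × ℕ) × (ℕ × ℕ) =>
    ENNReal.ofReal (wt ab.1 * wt ab.2)) Y hs1 (fun ab => (hYm ab).aemeasurable) _ hright WW_ne_top
  have hle : ∫⁻ q : (ℝ × ℝ × ℝ) × (ℝ × ℝ), H (q.1 + (0, q.2)) ∂(volume.prod nu) ≤
      ∫⁻ q, (∑' ab : (ℕ × ℕ) × (ℕ × ℕ), ENNReal.ofReal (wt ab.1 * wt ab.2) * Y ab q) ^ s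
        ∂(volume.prod nu) := by
    refine lintegral_mono_ae ?_
    filter_upwards [Measure.quasiMeasurePreserving_snd.ae ae_nu] with q hq
    refine ENNReal.rpow_le_rpow ?_ hs0.le
    exact pointwise_shift S hf hfi hg hgi hfs hgs q.1 hq.1 hq.2
  rw [hleft] at hle
  have := hle.trans hmain
  rw [mul_left_comm] at this
  exact (ENNReal.mul_le_mul_iff_right hν0 hνt).1 this

open MeasureTheory Set
open scoped ENNReal

/-- Relation between neighbouring cells in the Whitney decomposition. -/
def PP (m m' : ℤ) : Prop := 2 ≤ |m - m'| ∧ |m / 2 - m' / 2| ≤ 1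

theorem PP_abs {m c : ℤ} (h : PP m (m + c)) : 2 ≤ |c| ∧ |c| ≤ 5 := by
  obtain ⟨h1, h2⟩ := h
  rw [abs_le] at *
  rw [le_abs] at *
  omega

/-- Dyadic cell number. -/
noncomputable def fl (j : ℕ) (x : ℝ) : ℤ := ⌊(2 : ℝ) ^ j * x⌋

theorem measurable_fl (j : ℕ) : Measurable (fl j) := by
  unfold fl; fun_prop

theorem fl_succ (j : ℕ) (x : ℝ) : fl (j + 1) x / 2 = fl j x := by
  unfold fl
  symm
  rw [Int.floor_eq_iff]
  have h1 := Int.floor_le ((2 : ℝ) ^ (j + 1) * x)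
  have h2 := Int.lt_floor_add_one ((2 : ℝ) ^ (j + 1) * x)
  set m := ⌊(2 : ℝ) ^ (j + 1) * x⌋
  rw [pow_succ] at h1 h2
  have h3 : 2 * (m / 2) ≤ m := by omega
  have h4 : m + 1 ≤ 2 * (m / 2 + 1) := by omega
  have h3' : (2 : ℝ) * ((m / 2 : ℤ) : ℝ) ≤ m := by exact_mod_cast h3
  have h4' : (m : ℝ) + 1 ≤ 2 * (((m / 2 : ℤ) : ℝ) + 1) := by exact_mod_cast h4
  constructor <;> nlinarith

theorem fl_mem {x : ℝ} (hx : x ∈ Ico (0 : ℝ) 1) (j : ℕ) : fl j x ∈ Finset.Ico (0 : ℤ) (2 ^ j) := by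
  rw [Finset.mem_Ico]
  unfold fl
  constructor
  · exact Int.floor_nonneg.2 (by have := hx.1; positivity)
  · rw [Int.floor_lt]
    push_cast
    have := hx.2
    have h2 : (0 : ℝ) < 2 ^ j := by positivity
    nlinarith

theorem fl_mono {x y : ℝ} {i j : ℕ} (hij : i ≤ j) (h : 2 ≤ |fl i x - fl i y|) :
    2 ≤ |fl j x - fl j y| := by
  induction j, hij using Nat.le_induction with
  | base => exact h
  | succ n hn ih =>
    rw [← fl_succ n x, ← fl_succ n y] at ih
    rw [le_abs] at *
    omega

/-- One-dimensional Whitney pieces. -/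
def UU (q : ℕ × ℤ) : Set (ℝ × ℝ) :=
  {z | fl q.1 z.2 - fl q.1 z.1 = q.2 ∧ PP (fl q.1 z.1) (fl q.1 z.2)}

theorem measurableSet_UU (q : ℕ × ℤ) : MeasurableSet (UU q) := by
  have hm : Measurable (fun z : ℝ × ℝ => (fl q.1 z.1, fl q.1 z.2)) :=
    ((measurable_fl _).comp measurable_fst).prodMk ((measurable_fl _).comp measurable_snd)
  exact hm (MeasurableSet.of_discrete (s := {w : ℤ × ℤ | w.2 - w.1 = q.2 ∧ PP w.1 w.2}))

theorem UU_inj {q q' : ℕ × ℤ} {z : ℝ × ℝ} (h : z ∈ UU q) (h' : z ∈ UU q') : q = q' := by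
  have key : ∀ {q q' : ℕ × ℤ}, z ∈ UU q → z ∈ UU q' → ¬ q.1 < q'.1 := by
    intro q q' h h' hlt
    obtain ⟨i, hi⟩ : ∃ i, q'.1 = i + 1 := ⟨q'.1 - 1, by omega⟩
    have h1 := fl_mono (i := q.1) (j := i) (by omega) h.2.1
    have h2 := h'.2.2
    rw [hi, fl_succ, fl_succ] at h2
    omega
  have h1 := key h h'
  have h2 := key h' h
  have h3 : q.1 = q'.1 := by omega
  refine Prod.ext h3 ?_
  rw [← h.1, ← h'.1, h3]

theorem UU_cover {x y : ℝ} (hx : x ∈ Ico (0 : ℝ) 1) (hy : y ∈ Ico (0 : ℝ) 1) (hxy : x ≠ y) :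
    ∃ q, (x, y) ∈ UU q := by
  have hex : ∃ j, 2 ≤ |fl j x - fl j y| := by
    have hpos : 0 < |x - y| := abs_pos.2 (sub_ne_zero.2 hxy)
    obtain ⟨j, hj⟩ := pow_unbounded_of_one_lt (3 / |x - y|) (one_lt_two (α := ℝ))
    refine ⟨j, ?_⟩
    rw [div_lt_iff₀ hpos] at hj
    have e : (2 : ℝ) ^ j * |x - y| = |2 ^ j * x - 2 ^ j * y| := by
      rw [← mul_sub, abs_mul, abs_of_pos (by positivity : (0 : ℝ) < 2 ^ j)]
    rw [e, lt_abs] at hj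
    unfold fl
    have h1 := Int.floor_le ((2 : ℝ) ^ j * x)
    have h2 := Int.lt_floor_add_one ((2 : ℝ) ^ j * x)
    have h3 := Int.floor_le ((2 : ℝ) ^ j * y)
    have h4 := Int.lt_floor_add_one ((2 : ℝ) ^ j * y)
    set m := ⌊(2 : ℝ) ^ j * x⌋
    set n := ⌊(2 : ℝ) ^ j * y⌋
    rw [le_abs]
    rcases hj with hj | hj
    · left
      have : (2 : ℝ) < (m - n : ℤ) + 1 + 0 := by push_cast; linarith
      have : (1 : ℝ) < (m - n : ℤ) := by linarith
      have : (1 : ℤ) < m - n := by exact_mod_cast this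
      omega
    · right
      have : (1 : ℝ) < (n - m : ℤ) := by push_cast; linarith
      have : (1 : ℤ) < n - m := by exact_mod_cast this
      omega
  classical
  have hfind := Nat.find_spec hex
  have hmin := fun m => Nat.find_min hex (m := m)
  set j := Nat.find hex
  have hj0 : j ≠ 0 := by
    intro h0
    rw [h0] at hfind
    have a := fl_mem hx 0
    have b := fl_mem hy 0
    rw [Finset.mem_Ico] at a b
    rw [le_abs] at hfind
    simp only [pow_zero] at a b
    omega
  obtain ⟨i, hi⟩ : ∃ i, j = i + 1 := ⟨j - 1, by omega⟩
  refine ⟨(j, fl j y - fl j x), rfl, hfind, ?_⟩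
  have := hmin i (by omega)
  simp only [hi, fl_succ]
  omega

/-- Restriction of `f` to a cell. -/
noncomputable def cellf (f : ℝ × ℝ → ℂ) (j k : ℕ) (m : ℤ × ℤ) : ℝ × ℝ → ℂ :=
  {ξ : ℝ × ℝ | fl j ξ.1 = m.1 ∧ fl k ξ.2 = m.2}.indicator f

theorem measurableSet_cell (j k : ℕ) (m : ℤ × ℤ) :
    MeasurableSet {ξ : ℝ × ℝ | fl j ξ.1 = m.1 ∧ fl k ξ.2 = m.2} := by
  have hm : Measurable (fun z : ℝ × ℝ => (fl j z.1, fl k z.2)) :=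
    ((measurable_fl _).comp measurable_fst).prodMk ((measurable_fl _).comp measurable_snd)
  exact hm (MeasurableSet.of_discrete (s := {w : ℤ × ℤ | w.1 = m.1 ∧ w.2 = m.2}))

theorem measurable_cellf {f : ℝ × ℝ → ℂ} (hf : Measurable f) (j k : ℕ) (m : ℤ × ℤ) :
    Measurable (cellf f j k m) := hf.indicator (measurableSet_cell j k m)

theorem norm_cellf_le (f : ℝ × ℝ → ℂ) (j k : ℕ) (m : ℤ × ℤ) (ξ : ℝ × ℝ) :
    ‖cellf f j k m ξ‖ ≤ ‖f ξ‖ := norm_indicator_le_norm_self _ _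

/-- Index set of a Whitney piece. -/
noncomputable def SS (q q' : ℕ × ℤ) : Finset (ℤ × ℤ) := by
  classical
  exact (Finset.Ico (0 : ℤ) (2 ^ q.1) ×ˢ Finset.Ico (0 : ℤ) (2 ^ q'.1)).filter
    (fun m => PP m.1 (m.1 + q.2) ∧ PP m.2 (m.2 + q'.2))

theorem card_SS (q q' : ℕ × ℤ) : (SS q q').card ≤ 2 ^ q.1 * 2 ^ q'.1 := by
  classical
  refine (Finset.card_filter_le _ _).trans ?_
  rw [Finset.card_product, Int.card_Ico, Int.card_Ico]
  apply le_of_eq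
  congr 1 <;> simp

/-- Two-dimensional Whitney pieces. -/
def WS (Q : (ℕ × ℤ) × (ℕ × ℤ)) : Set ((ℝ × ℝ) × (ℝ × ℝ)) :=
  {z | (z.1.1, z.2.1) ∈ UU Q.1 ∧ (z.1.2, z.2.2) ∈ UU Q.2}

theorem measurableSet_WS (Q : (ℕ × ℤ) × (ℕ × ℤ)) : MeasurableSet (WS Q) := by
  have h1 : Measurable (fun z : (ℝ × ℝ) × (ℝ × ℝ) => (z.1.1, z.2.1)) := by fun_prop
  have h2 : Measurable (fun z : (ℝ × ℝ) × (ℝ × ℝ) => (z.1.2, z.2.2)) := by fun_prop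
  exact (h1 (measurableSet_UU Q.1)).inter (h2 (measurableSet_UU Q.2))

/-- The bilinear piece. -/
noncomputable def HH (f : ℝ × ℝ → ℂ) (Q : (ℕ × ℤ) × (ℕ × ℤ)) (p : ℝ × ℝ × ℝ) : ℂ :=
  ∑ m ∈ SS Q.1 Q.2, extOp (cellf f Q.1.1 Q.2.1 m) p *
    extOp (cellf f Q.1.1 Q.2.1 (m.1 + Q.1.2, m.2 + Q.2.2)) p

theorem indicator_WS {f : ℝ × ℝ → ℂ}
    (hs : Function.support f ⊆ Ico (0 : ℝ) 1 ×ˢ Ico (0 : ℝ) 1) (p : ℝ × ℝ × ℝ)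
    (Q : (ℕ × ℤ) × (ℕ × ℤ)) (z : (ℝ × ℝ) × (ℝ × ℝ)) :
    (WS Q).indicator (fun z => (ph p z.1 * f z.1) * (ph p z.2 * f z.2)) z =
      ∑ m ∈ SS Q.1 Q.2, (ph p z.1 * cellf f Q.1.1 Q.2.1 m z.1) *
        (ph p z.2 * cellf f Q.1.1 Q.2.1 (m.1 + Q.1.2, m.2 + Q.2.2) z.2) := by
  classical
  by_cases h0 : f z.1 = 0
  · have : ∀ m, cellf f Q.1.1 Q.2.1 m z.1 = 0 := by
      intro m
      simp only [cellf, indicator, h0, ite_self]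
    simp only [indicator, h0, this, mul_zero, zero_mul, ite_self, Finset.sum_const_zero]
  have hz : z.1 ∈ Ico (0 : ℝ) 1 ×ˢ Ico (0 : ℝ) 1 := hs h0
  by_cases hW : z ∈ WS Q
  · rw [indicator_of_mem hW]
    obtain ⟨⟨a1, a2⟩, b1, b2⟩ := hW
    simp only at a1 a2 b1 b2
    have ea : fl Q.1.1 z.2.1 = fl Q.1.1 z.1.1 + Q.1.2 := by omega
    have eb : fl Q.2.1 z.2.2 = fl Q.2.1 z.1.2 + Q.2.2 := by omega
    rw [Finset.sum_eq_single (fl Q.1.1 z.1.1, fl Q.2.1 z.1.2)]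
    · simp only [cellf, indicator, mem_setOf_eq, ea, eb, and_self, if_true]
    · intro m _ hm
      have : cellf f Q.1.1 Q.2.1 m z.1 = 0 := by
        apply indicator_of_notMem
        rintro ⟨h1, h2⟩
        exact hm (Prod.ext h1.symm h2.symm)
      rw [this]; simp
    · intro hn
      exfalso; apply hn
      unfold SS
      rw [Finset.mem_filter, Finset.mem_product]
      refine ⟨⟨fl_mem hz.1 _, fl_mem hz.2 _⟩, ?_, ?_⟩
      · rw [← ea]; exact a2
      · rw [← eb]; exact b2
  · rw [indicator_of_notMem hW]
    symm
    refine Finset.sum_eq_zero fun m hm => ?_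
    unfold SS at hm
    rw [Finset.mem_filter] at hm
    by_cases h1 : fl Q.1.1 z.1.1 = m.1 ∧ fl Q.2.1 z.1.2 = m.2
    · have : cellf f Q.1.1 Q.2.1 (m.1 + Q.1.2, m.2 + Q.2.2) z.2 = 0 := by
        apply indicator_of_notMem
        rintro ⟨h3, h4⟩
        simp only at h3 h4
        apply hW
        refine ⟨⟨?_, ?_⟩, ?_, ?_⟩
        · simp only; omega
        · simp only [h1.1, h3]; exact hm.2.1
        · simp only; omega
        · simp only [h1.2, h4]; exact hm.2.2
      rw [this]; simp
    · have : cellf f Q.1.1 Q.2.1 m z.1 = 0 := by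
        apply indicator_of_notMem
        exact h1
      rw [this]; simp

theorem integral_WS {f : ℝ × ℝ → ℂ} (hf : Measurable f) (hfi : Integrable f)
    (hs : Function.support f ⊆ Ico (0 : ℝ) 1 ×ˢ Ico (0 : ℝ) 1) (p : ℝ × ℝ × ℝ)
    (Q : (ℕ × ℤ) × (ℕ × ℤ)) :
    ∫ z in WS Q, (ph p z.1 * f z.1) * (ph p z.2 * f z.2) = HH f Q p := by
  rw [← integral_indicator (measurableSet_WS Q)]
  simp_rw [indicator_WS hs p Q]
  have hci : ∀ m, Integrable (fun ξ => ph p ξ * cellf f Q.1.1 Q.2.1 m ξ) := fun m =>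
    integrable_ph_mul (hfi.indicator (measurableSet_cell _ _ _)) p
  rw [integral_finsetSum]
  · unfold HH
    refine Finset.sum_congr rfl fun m _ => ?_
    rw [extOp_eq, extOp_eq]
    exact integral_prod_mul (fun ξ => ph p ξ * cellf f Q.1.1 Q.2.1 m ξ)
      (fun ξ => ph p ξ * cellf f Q.1.1 Q.2.1 (m.1 + Q.1.2, m.2 + Q.2.2) ξ)
  · intro m _
    exact (hci m).mul_prod (hci _)

theorem null_diag1 : ∀ᵐ z : (ℝ × ℝ) × (ℝ × ℝ), z.1.1 ≠ z.2.1 ∧ z.1.2 ≠ z.2.2 := by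
  have key : ∀ φ : ℝ × ℝ → ℝ, Measurable φ → (∀ t, volume {η | t = φ η} = 0) →
      ∀ᵐ z : (ℝ × ℝ) × (ℝ × ℝ), φ z.1 ≠ φ z.2 := by
    intro φ hφ h0
    rw [ae_iff]
    have hm : MeasurableSet {z : (ℝ × ℝ) × (ℝ × ℝ) | ¬ φ z.1 ≠ φ z.2} := by
      simp only [not_not]
      exact measurableSet_eq_fun (hφ.comp measurable_fst) (hφ.comp measurable_snd)
    change (volume.prod volume) _ = 0
    rw [Measure.measure_prod_null hm]
    refine Filter.Eventually.of_forall fun ξ => ?_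
    simpa using h0 (φ ξ)
  refine (key Prod.fst measurable_fst ?_).and (key Prod.snd measurable_snd ?_)
  · intro t
    have : {η : ℝ × ℝ | t = η.1} = {t} ×ˢ univ := by ext; simp [eq_comm]
    rw [this, Measure.volume_eq_prod, Measure.prod_prod]; simp
  · intro t
    have : {η : ℝ × ℝ | t = η.2} = univ ×ˢ {t} := by ext; simp [eq_comm]
    rw [this, Measure.volume_eq_prod, Measure.prod_prod]; simp

theorem hasSum_HH {f : ℝ × ℝ → ℂ} (hf : Measurable f) (hfi : Integrable f)
    (hs : Function.support f ⊆ Ico (0 : ℝ) 1 ×ˢ Ico (0 : ℝ) 1) (p : ℝ × ℝ × ℝ) :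
    HasSum (fun Q => HH f Q p) (extOp f p * extOp f p) := by
  have hInteg : Integrable (fun z : (ℝ × ℝ) × (ℝ × ℝ) =>
      (ph p z.1 * f z.1) * (ph p z.2 * f z.2)) :=
    (integrable_ph_mul hfi p).mul_prod (integrable_ph_mul hfi p)
  have h := hasSum_integral_iUnion (μ := volume) measurableSet_WS ?_ hInteg.integrableOn
  · simp_rw [integral_WS hf hfi hs] at h
    rw [setIntegral_eq_integral_of_ae_compl_eq_zero] at h
    · have e : ∫ z : (ℝ × ℝ) × (ℝ × ℝ), (ph p z.1 * f z.1) * (ph p z.2 * f z.2) =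
          extOp f p * extOp f p := by
        rw [extOp_eq]
        exact integral_prod_mul (fun ξ => ph p ξ * f ξ) (fun ξ => ph p ξ * f ξ)
      rw [e] at h
      exact h
    · filter_upwards [null_diag1] with z hz hn
      by_contra hne
      have h1 : f z.1 ≠ 0 := by rintro h; simp [h] at hne
      have h2 : f z.2 ≠ 0 := by rintro h; simp [h] at hne
      have m1 := hs h1
      have m2 := hs h2
      obtain ⟨q, hq⟩ := UU_cover m1.1 m2.1 hz.1
      obtain ⟨q', hq'⟩ := UU_cover m1.2 m2.2 hz.2
      exact hn (mem_iUnion.2 ⟨(q, q'), hq, hq'⟩)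
  · intro Q Q' hQ
    rw [Function.onFun, Set.disjoint_left]
    intro z h1 h2
    exact hQ (Prod.ext (UU_inj h1.1 h2.1) (UU_inj h1.2 h2.2))

open MeasureTheory Set
open scoped ENNReal

/-- Minkowski inequality for countable sums. -/
theorem minkowski_tsum {ι : Type} [Countable ι] {s : ℝ} (hs : 1 ≤ s) {G : ℝ × ℝ × ℝ → ℂ}
    {H : ι → ℝ × ℝ × ℝ → ℂ} (hH : ∀ i, Measurable (H i)) (w : ι → ℝ≥0∞) (B : ℝ≥0∞)
    (hW : ∑' i, w i ≠ ∞) (hG : ∀ p, ‖G p‖ₑ ≤ ∑' i, ‖H i p‖ₑ)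
    (h0 : ∀ i, w i = 0 → ∀ p, H i p = 0)
    (hB : ∀ i, eLpNorm (H i) (ENNReal.ofReal s) volume ≤ w i * B) :
    eLpNorm G (ENNReal.ofReal s) volume ≤ (∑' i, w i) * B := by
  have hs0 : 0 < s := by linarith
  have hwt : ∀ i, w i ≠ ∞ := fun i => ne_top_of_le_ne_top hW (ENNReal.le_tsum i)
  have key := lintegral_jensen (volume : Measure (ℝ × ℝ × ℝ)) w
    (fun i p => if w i = 0 then 0 else (w i)⁻¹ * ‖H i p‖ₑ) hs ?_ (B ^ s) ?_ hW
  · rw [eLp_eq hs0]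
    calc (∫⁻ p, ‖G p‖ₑ ^ s) ^ (1 / s) ≤ ((∑' i, w i) ^ s * B ^ s) ^ (1 / s) := by
          refine ENNReal.rpow_le_rpow (le_trans (lintegral_mono fun p => ?_) key) (by positivity)
          refine ENNReal.rpow_le_rpow ((hG p).trans (ENNReal.tsum_le_tsum fun i => ?_)) hs0.le
          split_ifs with hi
          · simp [h0 i hi p]
          · rw [← mul_assoc, ENNReal.mul_inv_cancel hi (hwt i), one_mul]
      _ = _ := by
          rw [← ENNReal.mul_rpow_of_nonneg _ _ hs0.le, ← ENNReal.rpow_mul,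
            mul_one_div_cancel hs0.ne', ENNReal.rpow_one]
  · intro i
    split_ifs with hi
    · exact aemeasurable_const
    · exact ((hH i).enorm.const_mul _).aemeasurable
  · intro i
    by_cases hi : w i = 0
    · simp [hi, hs0]
    · simp only [hi, if_false]
      have h1 : ∫⁻ p, ((w i)⁻¹ * ‖H i p‖ₑ) ^ s = (w i)⁻¹ ^ s * ∫⁻ p, ‖H i p‖ₑ ^ s := by
        simp_rw [ENNReal.mul_rpow_of_nonneg _ _ hs0.le]
        exact lintegral_const_mul' _ _ (ENNReal.rpow_ne_top_of_nonneg hs0.le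
          (ENNReal.inv_ne_top.2 hi))
      have h2 := ENNReal.rpow_le_rpow (hB i) hs0.le
      rw [eLp_eq hs0, ← ENNReal.rpow_mul, one_div_mul_cancel hs0.ne', ENNReal.rpow_one] at h2
      rw [h1]
      calc _ ≤ (w i)⁻¹ ^ s * (w i * B) ^ s := by gcongr
        _ = B ^ s := by
          rw [← ENNReal.mul_rpow_of_nonneg _ _ hs0.le, ← mul_assoc,
            ENNReal.inv_mul_cancel hi (hwt i), one_mul]

theorem measurable_HH {f : ℝ × ℝ → ℂ} (hf : Measurable f) (Q : (ℕ × ℤ) × (ℕ × ℤ)) :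
    Measurable (HH f Q) := by
  unfold HH
  exact Finset.measurable_fun_sum _ fun m _ =>
    (measurable_extOp (measurable_cellf hf _ _ _)).mul
      (measurable_extOp (measurable_cellf hf _ _ _))

theorem tsum_prod_mul' {α β : Type} (u : α → ℝ≥0∞) (v : β → ℝ≥0∞) :
    ∑' x : α × β, u x.1 * v x.2 = (∑' a, u a) * ∑' b, v b := by
  rw [ENNReal.tsum_prod (f := fun a b => u a * v b)]
  simp_rw [ENNReal.tsum_mul_left]
  rw [ENNReal.tsum_mul_right]

/-- Weights. -/
noncomputable def wq (θ : ℝ) (q : ℕ × ℤ) : ℝ≥0∞ :=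
  if 2 ≤ |q.2| ∧ |q.2| ≤ 5 then ENNReal.ofReal ((2 : ℝ)⁻¹ ^ q.1) ^ θ else 0

theorem tsum_wq {θ : ℝ} (hθ : 0 < θ) : ∑' q, wq θ q ≠ ∞ := by
  have hle : ∀ q : ℕ × ℤ, wq θ q ≤ (ENNReal.ofReal (2 : ℝ)⁻¹ ^ θ) ^ q.1 *
      (if q.2 ∈ Finset.Icc (-5 : ℤ) 5 then 1 else 0) := by
    intro q
    unfold wq
    split_ifs with h1 h2
    · rw [ENNReal.ofReal_pow (by positivity), mul_one, ← ENNReal.rpow_natCast,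
        ← ENNReal.rpow_mul, mul_comm, ENNReal.rpow_mul, ENNReal.rpow_natCast]
    · exfalso; apply h2
      rw [Finset.mem_Icc]
      exact abs_le.1 h1.2
    · exact zero_le
    · exact zero_le
  refine ne_top_of_le_ne_top ?_ (ENNReal.tsum_le_tsum hle)
  rw [tsum_prod_mul' (fun n : ℕ => (ENNReal.ofReal (2 : ℝ)⁻¹ ^ θ) ^ n)
    (fun c : ℤ => if c ∈ Finset.Icc (-5 : ℤ) 5 then 1 else 0), ENNReal.tsum_geometric]
  refine ENNReal.mul_ne_top ?_ ?_
  · rw [ENNReal.inv_ne_top]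
    apply ne_of_gt
    apply tsub_pos_of_lt
    apply ENNReal.rpow_lt_one _ hθ
    rw [ENNReal.ofReal_lt_one]; norm_num
  · rw [tsum_eq_sum (s := Finset.Icc (-5 : ℤ) 5)]
    · exact ENNReal.sum_ne_top.2 fun i _ => by split_ifs <;> simp
    · intro b hb; simp only [hb, if_false]

theorem eLp_HH {s r A : ℝ} (hs1 : 1 ≤ s) (hs2 : s < 2) (hBH : BH s r A) {f : ℝ × ℝ → ℂ}
    (hf : Measurable f) (hfb : ∀ ξ, ‖f ξ‖ ≤ 1) (Q : (ℕ × ℤ) × (ℕ × ℤ))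
    (h1 : 2 ≤ |Q.1.2| ∧ |Q.1.2| ≤ 5) (h2 : 2 ≤ |Q.2.2| ∧ |Q.2.2| ≤ 5) :
    eLpNorm (HH f Q) (ENNReal.ofReal s) volume ≤
      wq (2 - 3 / s) Q.1 * wq (2 - 3 / s) Q.2 * (WW * ENNReal.ofReal A) := by
  have hs0 : 0 < s := by linarith
  set a : ℝ := (2 : ℝ)⁻¹ ^ Q.1.1 with ha
  set b : ℝ := (2 : ℝ)⁻¹ ^ Q.2.1 with hb
  have ha0 : 0 < a := by positivity
  have hb0 : 0 < b := by positivity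
  have hab : 0 < a * b := by positivity
  have haj : (2 : ℝ) ^ Q.1.1 * a = 1 := by rw [ha, ← mul_pow]; norm_num
  have hbj : (2 : ℝ) ^ Q.2.1 * b = 1 := by rw [hb, ← mul_pow]; norm_num
  set t := ENNReal.ofReal (a * b) with ht
  have ht0 : t ≠ 0 := by rw [ht]; simpa using hab
  have htt : t ≠ ∞ := ENNReal.ofReal_ne_top
  set F : ℤ × ℤ → ℝ × ℝ → ℂ := fun m => cellf f Q.1.1 Q.2.1 m ∘ aff2 a b 0 0 with hF
  have hFm : ∀ m, Measurable (F m) := fun m =>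
    (measurable_cellf hf _ _ _).comp (measurable_aff2 _ _ _ _)
  have hFb : ∀ m ξ, ‖F m ξ‖ ≤ 1 := fun m ξ => (norm_cellf_le f _ _ m _).trans (hfb _)
  have hFs : ∀ m : ℤ × ℤ, Function.support (F m) ⊆ unitSq m.1 m.2 := by
    intro m ξ hξ
    have hmem : aff2 a b 0 0 ξ ∈ {ξ : ℝ × ℝ | fl Q.1.1 ξ.1 = m.1 ∧ fl Q.2.1 ξ.2 = m.2} := by
      by_contra hn
      exact hξ (indicator_of_notMem hn _)
    obtain ⟨e1, e2⟩ := hmem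
    simp only [aff2, zero_add, fl] at e1 e2
    rw [← mul_assoc, haj, one_mul, Int.floor_eq_iff] at e1
    rw [← mul_assoc, hbj, one_mul, Int.floor_eq_iff] at e2
    exact ⟨⟨e1.1, e1.2.le⟩, e2.1, e2.2.le⟩
  have horth := orth hs1 hs2 hBH (SS Q.1 Q.2) (c := Q.1.2) (d := Q.2.2)
    (by exact_mod_cast h1.1) (by exact_mod_cast h1.2) (by exact_mod_cast h2.1)
    (by exact_mod_cast h2.2) hFm hFb (fun m => hFm (m.1 + Q.1.2, m.2 + Q.2.2))
    (fun m => hFb (m.1 + Q.1.2, m.2 + Q.2.2)) hFs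
    (fun m => by simpa using hFs (m.1 + Q.1.2, m.2 + Q.2.2))
  set H' : ℝ × ℝ × ℝ → ℂ := fun p => ∑ m ∈ SS Q.1 Q.2, extOp (F m) p *
    extOp (F (m.1 + Q.1.2, m.2 + Q.2.2)) p with hH'
  have hH'm : Measurable H' := Finset.measurable_fun_sum _ fun m _ =>
    (measurable_extOp (hFm _)).mul (measurable_extOp (hFm _))
  have hscale := eLp_scale hs0 ha0 hb0 0 0 (H := HH f Q) hH'm (t ^ (2 : ℝ))
    (ENNReal.rpow_ne_top_of_nonneg (by norm_num) htt) ?_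
  · rw [hscale, eLp_eq hs0]
    have hcard : ((SS Q.1 Q.2).card : ℝ≥0∞) ≤ t⁻¹ := by
      have e : t⁻¹ = ENNReal.ofReal (2 ^ Q.1.1 * 2 ^ Q.2.1) := by
        rw [ht, ← ENNReal.ofReal_inv_of_pos hab]
        congr 1
        rw [ha, hb]; simp [mul_comm]
      rw [e]
      have := card_SS Q.1 Q.2
      rw [← ENNReal.ofReal_natCast]
      apply ENNReal.ofReal_le_ofReal
      exact_mod_cast this
    calc t ^ (2 : ℝ) * t ^ (-(2 / s)) * (∫⁻ p, ‖H' p‖ₑ ^ s) ^ (1 / s)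
        ≤ t ^ (2 : ℝ) * t ^ (-(2 / s)) * (WW ^ s * (t⁻¹ * ENNReal.ofReal A ^ s)) ^ (1 / s) := by
          gcongr
          exact horth.trans (by gcongr)
      _ = t ^ (2 - 3 / s) * (WW * ENNReal.ofReal A) := by
          have h1s : 0 ≤ 1 / s := by positivity
          rw [ENNReal.mul_rpow_of_nonneg _ _ h1s, ENNReal.mul_rpow_of_nonneg _ _ h1s,
            ← ENNReal.rpow_mul, ← ENNReal.rpow_mul, mul_one_div_cancel hs0.ne', ENNReal.rpow_one,
            ENNReal.rpow_one, ← ENNReal.rpow_neg_one, ← ENNReal.rpow_mul]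
          have e : (2 : ℝ) - 3 / s = 2 + -(2 / s) + -1 * (1 / s) := by ring
          rw [e, ENNReal.rpow_add _ _ ht0 htt, ENNReal.rpow_add _ _ ht0 htt]
          ring
      _ = _ := by
          unfold wq
          rw [if_pos h1, if_pos h2, ← ha, ← hb,
            ← ENNReal.mul_rpow_of_ne_top ENNReal.ofReal_ne_top ENNReal.ofReal_ne_top,
            ← ENNReal.ofReal_mul ha0.le]
  · intro p
    have e : HH f Q p = ((a * b : ℝ) * Complex.exp (Complex.I *
        (p.1 * 0 * 0 + p.2.1 * 0 + p.2.2 * 0 : ℝ))) ^ 2 * H' (lin3 a b 0 0 p) := by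
      simp only [HH, hH', Finset.mul_sum]
      refine Finset.sum_congr rfl fun m _ => ?_
      rw [enorm_extOp_scale _ ha0 hb0 0 0 p,
        enorm_extOp_scale (cellf f Q.1.1 Q.2.1 (m.1 + Q.1.2, m.2 + Q.2.2)) ha0 hb0 0 0 p]
      ring
    rw [e, enorm_mul]
    congr 1
    simp only [mul_zero, add_zero, Complex.ofReal_zero, Complex.exp_zero, mul_one]
    rw [← ofReal_norm, norm_pow, Complex.norm_real, Real.norm_of_nonneg hab.le,
      ENNReal.ofReal_pow hab.le, ← ht]
    norm_cast

/-- The constant in the linear estimate (squared). -/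
noncomputable def CL (s A : ℝ) : ℝ≥0∞ :=
  (∑' q, wq (2 - 3 / s) q) * (∑' q, wq (2 - 3 / s) q) * (WW * ENNReal.ofReal A)

theorem CL_ne_top {s A : ℝ} (hs : 3 / 2 < s) : CL s A ≠ ∞ := by
  have hθ : 0 < 2 - 3 / s := by
    rw [sub_pos, div_lt_iff₀ (by linarith)]; linarith
  unfold CL
  exact ENNReal.mul_ne_top (ENNReal.mul_ne_top (tsum_wq hθ) (tsum_wq hθ))
    (ENNReal.mul_ne_top WW_ne_top ENNReal.ofReal_ne_top)

theorem wq_eq_zero {θ : ℝ} (hθ : 0 ≤ θ) {q : ℕ × ℤ} (h : wq θ q = 0) : ¬ (2 ≤ |q.2| ∧ |q.2| ≤ 5) := by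
  intro h1
  unfold wq at h
  rw [if_pos h1] at h
  have h2 : ENNReal.ofReal ((2 : ℝ)⁻¹ ^ q.1) ≠ 0 := by
    rw [Ne, ENNReal.ofReal_eq_zero, not_le]; positivity
  rw [ENNReal.rpow_eq_zero_iff] at h
  rcases h with h | h
  · exact h2 h.1
  · linarith [h.2]

theorem lin_unit {s r A : ℝ} (hs1 : 3 / 2 < s) (hs2 : s < 2) (hBH : BH s r A) {f : ℝ × ℝ → ℂ}
    (hf : Measurable f) (hfb : ∀ ξ, ‖f ξ‖ ≤ 1)
    (hs : Function.support f ⊆ Ico (0 : ℝ) 1 ×ˢ Ico (0 : ℝ) 1) :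
    eLpNorm (fun p => extOp f p * extOp f p) (ENNReal.ofReal s) volume ≤ CL s A := by
  have hθ : 0 < 2 - 3 / s := by
    rw [sub_pos, div_lt_iff₀ (by linarith)]; linarith
  have hvol : volume (Ico (0 : ℝ) 1 ×ˢ Ico (0 : ℝ) 1) ≠ ∞ := by
    rw [Measure.volume_eq_prod, Measure.prod_prod]; simp
  have hfi := integrable_of_bdd hf hfb hvol hs
  have hprod : ∑' Q : (ℕ × ℤ) × (ℕ × ℤ), wq (2 - 3 / s) Q.1 * wq (2 - 3 / s) Q.2 =
      (∑' q, wq (2 - 3 / s) q) * (∑' q, wq (2 - 3 / s) q) :=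
    tsum_prod_mul' _ _
  have h0 : ∀ Q : (ℕ × ℤ) × (ℕ × ℤ), ¬ ((2 ≤ |Q.1.2| ∧ |Q.1.2| ≤ 5) ∧
      (2 ≤ |Q.2.2| ∧ |Q.2.2| ≤ 5)) → HH f Q = 0 := by
    intro Q hQ
    have : SS Q.1 Q.2 = ∅ := by
      classical
      rw [Finset.eq_empty_iff_forall_notMem]
      intro m hm
      unfold SS at hm
      rw [Finset.mem_filter] at hm
      exact hQ ⟨PP_abs hm.2.1, PP_abs hm.2.2⟩
    ext p
    simp [HH, this]
  have := minkowski_tsum (s := s) (by linarith) (G := fun p => extOp f p * extOp f p)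
    (H := fun Q => HH f Q) (measurable_HH hf)
    (fun Q => wq (2 - 3 / s) Q.1 * wq (2 - 3 / s) Q.2) (WW * ENNReal.ofReal A) ?_ ?_ ?_ ?_
  · rw [hprod] at this
    exact this
  · rw [hprod]
    exact ENNReal.mul_ne_top (tsum_wq hθ) (tsum_wq hθ)
  · intro p
    rw [← (hasSum_HH hf hfi hs p).tsum_eq]
    exact enorm_tsum_le_tsum_enorm
  · intro Q hQ p
    rw [h0 Q]
    · rfl
    · rintro ⟨h1, h2⟩
      rcases mul_eq_zero.1 hQ with h | h
      · exact wq_eq_zero hθ.le h h1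
      · exact wq_eq_zero hθ.le h h2
  · intro Q
    by_cases hQ : (2 ≤ |Q.1.2| ∧ |Q.1.2| ≤ 5) ∧ (2 ≤ |Q.2.2| ∧ |Q.2.2| ≤ 5)
    · exact eLp_HH (by linarith) hs2 hBH hf hfb Q hQ.1 hQ.2
    · rw [h0 Q hQ]; simp

theorem lin_rect {s r A : ℝ} (hs1 : 3 / 2 < s) (hs2 : s < 2) (hBH : BH s r A) {a b α β : ℝ}
    (ha : 0 < a) (hb : 0 < b) {F : Set (ℝ × ℝ)} (hF : MeasurableSet F)
    (hFs : ∀ ξ ∈ F, (α ≤ ξ.1 ∧ ξ.1 ≤ α + a) ∧ (β ≤ ξ.2 ∧ ξ.2 ≤ β + b)) :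
    eLpNorm (extOp (chi F)) (ENNReal.ofReal (2 * s)) volume ≤
      CL s A ^ (1 / 2 : ℝ) * ENNReal.ofReal (4 * (a * b)) ^ (1 - 1 / s) := by
  have hs0 : 0 < s := by linarith
  have h2s : 0 < 2 * s := by linarith
  have ha' : 0 < 2 * a := by linarith
  have hb' : 0 < 2 * b := by linarith
  set f := chi F ∘ aff2 (2 * a) (2 * b) α β with hf
  have hfm : Measurable f := (measurable_chi hF).comp (measurable_aff2 _ _ _ _)
  have hunit := lin_unit hs1 hs2 hBH hfm (fun ξ => norm_chi_le F _) ?_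
  · rw [eLp_scale h2s ha' hb' α β (measurable_extOp hfm) (ENNReal.ofReal (2 * a * (2 * b)))
      ENNReal.ofReal_ne_top (fun p => enorm_extOp_scale' (chi F) ha' hb' α β p)]
    have e : 2 * a * (2 * b) = 4 * (a * b) := by ring
    rw [e]
    have ht0 : ENNReal.ofReal (4 * (a * b)) ≠ 0 := by
      rw [Ne, ENNReal.ofReal_eq_zero, not_le]; positivity
    have e2 : ENNReal.ofReal (4 * (a * b)) * ENNReal.ofReal (4 * (a * b)) ^ (-(2 / (2 * s))) =
        ENNReal.ofReal (4 * (a * b)) ^ (1 - 1 / s) := by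
      have : 1 - 1 / s = 1 + -(2 / (2 * s)) := by field_simp; ring
      rw [this, ENNReal.rpow_add _ _ ht0 ENNReal.ofReal_ne_top, ENNReal.rpow_one]
    rw [e2, mul_comm]
    gcongr
    rw [eLp_eq h2s]
    rw [eLp_eq hs0] at hunit
    have h3 := ENNReal.rpow_le_rpow hunit (by norm_num : (0 : ℝ) ≤ 1 / 2)
    refine le_trans (le_of_eq ?_) h3
    rw [← ENNReal.rpow_mul]
    congr 1
    · refine lintegral_congr fun p => ?_
      rw [enorm_mul, ENNReal.mul_rpow_of_nonneg _ _ hs0.le, ← ENNReal.rpow_add_of_nonneg _ _ hs0.le hs0.le,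
        two_mul]
    · field_simp
  · intro θ hθ
    have hmem : aff2 (2 * a) (2 * b) α β θ ∈ F := by
      by_contra hn
      apply hθ
      simp only [hf, Function.comp, chi, indicator_of_notMem hn]
    obtain ⟨⟨h1, h2⟩, h3, h4⟩ := hFs _ hmem
    simp only [aff2] at h1 h2 h3 h4
    refine ⟨⟨?_, ?_⟩, ?_, ?_⟩ <;> nlinarith

open MeasureTheory Set
open scoped ENNReal

theorem extOp_chi {S : Set (ℝ × ℝ)} (hS : MeasurableSet S) (p : ℝ × ℝ × ℝ) :
    extOp (chi S) p = ∫ ξ in S, ph p ξ := by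
  rw [extOp_eq, ← integral_indicator hS]
  refine integral_congr_ae (Filter.Eventually.of_forall fun ξ => ?_)
  by_cases h : ξ ∈ S <;> simp [chi, h]

theorem integrableOn_ph {S : Set (ℝ × ℝ)} (h : volume S ≠ ∞) (p : ℝ × ℝ × ℝ) :
    IntegrableOn (ph p) S :=
  Measure.integrableOn_of_bounded (M := 1) h (continuous_ph' p).aestronglyMeasurable
    (Filter.Eventually.of_forall fun ξ => (norm_ph p ξ).le)

theorem hasSum_extOp_chi {ι : Type} [Countable ι] {G : Set (ℝ × ℝ)} (hG : MeasurableSet G)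
    (hGv : volume G ≠ ∞) {T : ι → Set (ℝ × ℝ)} (hT : ∀ q, MeasurableSet (T q))
    (hd : ∀ q q' ξ, ξ ∈ T q → ξ ∈ T q' → q = q') (p : ℝ × ℝ × ℝ) :
    HasSum (fun q => extOp (chi (G ∩ T q)) p) (extOp (chi (G ∩ ⋃ q, T q)) p) := by
  have h := hasSum_integral_iUnion (μ := volume) (s := fun q => G ∩ T q) (f := ph p)
    (fun q => hG.inter (hT q)) ?_ ?_
  · rw [extOp_chi (hG.inter (MeasurableSet.iUnion hT)), inter_iUnion]
    simp_rw [fun q => extOp_chi (hG.inter (hT q))]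
    exact h
  · intro q q' hq
    rw [Function.onFun, Set.disjoint_left]
    intro ξ h1 h2
    exact hq (hd q q' ξ h1.2 h2.2)
  · rw [← inter_iUnion]
    exact (integrableOn_ph hGv p).mono_set inter_subset_left

/-- Corners. -/
noncomputable def cc : Fin 4 → ℝ := ![-4, -3, 2, 3]

theorem cc_abs (c : Fin 4) : 2 ≤ |cc c| ∧ |cc c| ≤ 5 := by
  fin_cases c <;> simp [cc, abs_of_pos] <;> norm_num

/-- Far intervals. -/
noncomputable def IP (γ l : ℝ) (q : ℕ × Fin 4) : Set ℝ :=
  Ico (γ + cc q.2 * (2 ^ q.1 * l)) (γ + (cc q.2 + 1) * (2 ^ q.1 * l))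

theorem IP_inj {γ l : ℝ} (hl : 0 < l) {q q' : ℕ × Fin 4} {t : ℝ} (h : t ∈ IP γ l q)
    (h' : t ∈ IP γ l q') : q = q' := by
  have key : ∀ {q q' : ℕ × Fin 4}, t ∈ IP γ l q → t ∈ IP γ l q' → ¬ q.1 < q'.1 := by
    rintro ⟨i, c⟩ ⟨i', c'⟩ h h' hlt
    simp only at hlt
    have h2 : (2 : ℝ) ^ (i + 1) ≤ 2 ^ i' := pow_le_pow_right₀ (by norm_num) hlt
    have h3 : 2 * (2 ^ i * l) ≤ 2 ^ i' * l := by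
      rw [pow_succ] at h2; nlinarith
    have h4 : 0 < 2 ^ i * l := by positivity
    obtain ⟨a1, a2⟩ := h
    obtain ⟨b1, b2⟩ := h'
    simp only at a1 a2 b1 b2
    generalize 2 ^ i * l = a at *
    generalize 2 ^ i' * l = b at *
    fin_cases c <;> fin_cases c' <;> simp [cc] at a1 a2 b1 b2 <;> linarith
  have h1 := key h h'
  have h2 := key h' h
  obtain ⟨i, c⟩ := q
  obtain ⟨i', c'⟩ := q'
  simp only at h1 h2
  have h3 : i = i' := by omega
  subst h3
  congr 1
  have h4 : 0 < 2 ^ i * l := by positivity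
  obtain ⟨a1, a2⟩ := h
  obtain ⟨b1, b2⟩ := h'
  simp only at a1 a2 b1 b2
  generalize 2 ^ i * l = a at *
  fin_cases c <;> fin_cases c' <;> first | rfl | (exfalso; simp [cc] at a1 a2 b1 b2; linarith)

theorem IP_cover {γ l : ℝ} (hl : 0 < l) {t : ℝ} (ht : t < γ - 2 * l ∨ γ + 2 * l ≤ t) :
    ∃ q, t ∈ IP γ l q := by
  classical
  have arch : ∀ y : ℝ, ∃ i : ℕ, y < 4 * (2 ^ i * l) := by
    intro y
    obtain ⟨i, hi⟩ := pow_unbounded_of_one_lt (y / (4 * l)) (one_lt_two (α := ℝ))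
    rw [div_lt_iff₀ (by positivity)] at hi
    exact ⟨i, by linarith⟩
  rcases ht with ht | ht
  · have hex : ∃ i : ℕ, γ - 4 * (2 ^ i * l) ≤ t := by
      obtain ⟨i, hi⟩ := arch (γ - t)
      exact ⟨i, by linarith⟩
    have h1 := Nat.find_spec hex
    have hmin := fun m => Nat.find_min hex (m := m)
    set i := Nat.find hex
    have h2 : t < γ - 2 * (2 ^ i * l) := by
      rcases Nat.eq_zero_or_pos i with h0 | h0
      · rw [h0]; simpa using ht
      · have := hmin (i - 1) (by omega)
        have e : (2 : ℝ) ^ i = 2 ^ (i - 1) * 2 := by rw [← pow_succ]; congr 1; omega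
        rw [e]
        push Not at this
        linarith
    by_cases h3 : t < γ - 3 * (2 ^ i * l)
    · refine ⟨(i, 0), ?_, ?_⟩ <;> simp [cc] <;> linarith
    · refine ⟨(i, 1), ?_, ?_⟩ <;> simp [cc] <;> linarith
  · have hex : ∃ i : ℕ, t < γ + 4 * (2 ^ i * l) := by
      obtain ⟨i, hi⟩ := arch (t - γ)
      exact ⟨i, by linarith⟩
    have h1 := Nat.find_spec hex
    have hmin := fun m => Nat.find_min hex (m := m)
    set i := Nat.find hex
    have h2 : γ + 2 * (2 ^ i * l) ≤ t := by
      rcases Nat.eq_zero_or_pos i with h0 | h0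
      · rw [h0]; simpa using ht
      · have := hmin (i - 1) (by omega)
        have e : (2 : ℝ) ^ i = 2 ^ (i - 1) * 2 := by rw [← pow_succ]; congr 1; omega
        rw [e]
        push Not at this
        linarith
    by_cases h3 : t < γ + 3 * (2 ^ i * l)
    · refine ⟨(i, 2), ?_, ?_⟩ <;> simp [cc] <;> linarith
    · refine ⟨(i, 3), ?_, ?_⟩ <;> simp [cc] <;> linarith

/-- Exponential weights. -/
noncomputable def vq (e : ℝ) (M : ℕ) (q : ℕ × Fin 4) : ℝ :=
  ((2 : ℝ) ^ (-e)) ^ ((q.1 : ℤ) - (M : ℤ)).natAbs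

/-- The geometric constant. -/
noncomputable def Ce (e : ℝ) : ℝ≥0∞ :=
  ∑' z : ℤ, ENNReal.ofReal (((2 : ℝ) ^ (-e)) ^ z.natAbs)

theorem Ce_ne_top {e : ℝ} (he : 0 < e) : Ce e ≠ ∞ := by
  have h1 : (2 : ℝ) ^ (-e) < 1 := Real.rpow_lt_one_of_one_lt_of_neg (by norm_num) (by linarith)
  have h0 : (0 : ℝ) ≤ 2 ^ (-e) := by positivity
  have : Summable (fun z : ℤ => ((2 : ℝ) ^ (-e)) ^ z.natAbs) := by
    rw [summable_int_iff_summable_nat_and_neg]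
    constructor <;> simpa using summable_geometric_of_lt_one h0 h1
  exact this.tsum_ofReal_ne_top

theorem tsum_vq (e : ℝ) (M : ℕ) : ∑' q, ENNReal.ofReal (vq e M q) ≤ 4 * Ce e := by
  have h := tsum_prod_mul' (fun i : ℕ => ENNReal.ofReal (((2 : ℝ) ^ (-e)) ^
    ((i : ℤ) - (M : ℤ)).natAbs)) (fun _ : Fin 4 => (1 : ℝ≥0∞))
  simp only [mul_one] at h
  unfold vq
  rw [h, mul_comm]
  gcongr
  · simp
  · refine ENNReal.tsum_comp_le_tsum_of_injective (f := fun i : ℕ => (i : ℤ) - (M : ℤ)) ?_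
      (fun z : ℤ => ENNReal.ofReal (((2 : ℝ) ^ (-e)) ^ z.natAbs))
    intro i j hij
    simpa using hij

theorem weight_bound {σ e l : ℝ} (hσ : 2 * e ≤ σ) (he : 0 < e) (hl : 0 < l) (M : ℕ)
    (q : ℕ × Fin 4) :
    (2 ^ q.1 * l) ^ (-(2 * e)) * l ^ (σ + e) * (min (2 ^ M * l) (2 ^ q.1 * l)) ^ (σ + e) ≤
      (l * (2 ^ M * l)) ^ σ * 2 ^ (-(e * M)) * vq e M q := by
  obtain ⟨i, c⟩ := q
  unfold vq
  simp only
  obtain ⟨y, rfl⟩ : ∃ y : ℝ, l = (2 : ℝ) ^ y :=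
    ⟨Real.logb 2 l, (Real.rpow_logb (by norm_num) (by norm_num) hl).symm⟩
  have two : (0 : ℝ) < 2 := by norm_num
  rw [← Real.rpow_natCast _ ((i : ℤ) - (M : ℤ)).natAbs, ← Real.rpow_natCast 2 M,
    ← Real.rpow_natCast 2 i]
  have hn : ((((i : ℤ) - (M : ℤ)).natAbs : ℕ) : ℝ) = |(i : ℝ) - M| := by
    rw [Nat.cast_natAbs]; push_cast; rfl
  rw [hn]
  rcases le_total i M with h | h
  · have hR : (i : ℝ) ≤ M := by exact_mod_cast h
    have hmin : min ((2 : ℝ) ^ (M : ℝ) * 2 ^ y) (2 ^ (i : ℝ) * 2 ^ y) = 2 ^ (i : ℝ) * 2 ^ y := by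
      apply min_eq_right
      gcongr
      norm_num
    rw [hmin, abs_of_nonpos (by linarith)]
    simp only [← Real.rpow_add two, ← Real.rpow_mul two.le]
    apply Real.rpow_le_rpow_of_exponent_le (by norm_num)
    nlinarith [mul_nonneg (sub_nonneg.2 hR) (sub_nonneg.2 hσ)]
  · have hR : (M : ℝ) ≤ i := by exact_mod_cast h
    have hmin : min ((2 : ℝ) ^ (M : ℝ) * 2 ^ y) (2 ^ (i : ℝ) * 2 ^ y) = 2 ^ (M : ℝ) * 2 ^ y := by
      apply min_eq_left
      gcongr
      norm_num
    rw [hmin, abs_of_nonneg (by linarith)]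
    simp only [← Real.rpow_add two, ← Real.rpow_mul two.le]
    apply Real.rpow_le_rpow_of_exponent_le (by norm_num)
    nlinarith [mul_nonneg (sub_nonneg.2 hR) he.le]

theorem volume_rect_le {F : Set (ℝ × ℝ)} {a b c d : ℝ} (h : F ⊆ Icc a (a + c) ×ˢ Icc b (b + d)) 
    (hc : 0 ≤ c) : volume F ≤ ENNReal.ofReal (c * d) := by
  refine (measure_mono h).trans (le_of_eq ?_)
  rw [Measure.volume_eq_prod, Measure.prod_prod, Real.volume_Icc, Real.volume_Icc,
    ENNReal.ofReal_mul hc]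
  simp

/-- Far sets. -/
def farX (α l : ℝ) (q : ℕ × Fin 4) : Set (ℝ × ℝ) := {ξ | ξ.1 ∈ IP α l q}

/-- Far sets. -/
def farY (β k : ℝ) (q : ℕ × Fin 4) : Set (ℝ × ℝ) := {ξ | ξ.2 ∈ IP β k q}

theorem measurableSet_farX (α l : ℝ) (q : ℕ × Fin 4) : MeasurableSet (farX α l q) :=
  measurable_fst measurableSet_Ico

theorem measurableSet_farY (β k : ℝ) (q : ℕ × Fin 4) : MeasurableSet (farY β k q) :=
  measurable_snd measurableSet_Ico

theorem ofReal_aux1 {A X Y Z W : ℝ} (hX : 0 ≤ X) (hY : 0 ≤ Y) (h : X * (Y * Z) = W) :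
    ENNReal.ofReal A * ENNReal.ofReal X * (ENNReal.ofReal Y * ENNReal.ofReal Z) =
      ENNReal.ofReal A * ENNReal.ofReal W := by
  rw [← h, ENNReal.ofReal_mul hX, ENNReal.ofReal_mul hY, mul_assoc]

theorem ofReal_aux2 {A V V' Z W : ℝ} (hV : 0 ≤ V) (hV' : 0 ≤ V') (h : W = V * V' * Z) :
    ENNReal.ofReal A * ENNReal.ofReal W =
      ENNReal.ofReal V * ENNReal.ofReal V' * (ENNReal.ofReal A * ENNReal.ofReal Z) := by
  rw [h, ENNReal.ofReal_mul (mul_nonneg hV hV'), ENNReal.ofReal_mul hV]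
  ring

theorem far_piece {s r A e : ℝ} (hs0 : 1 < s) (hBH : BH s r A)
    (he : 0 < e) (hσ : 2 * e ≤ 1 - 1 / s) (hρ : r ≤ 0 ∨ 1 - 1 / s + e ≤ 1 / r)
    {l k α α' β β' : ℝ} (hl : 0 < l) (hk : 0 < k) (M N : ℕ) {F G : Set (ℝ × ℝ)}
    (hF : MeasurableSet F) (hG : MeasurableSet G)
    (hFs : F ⊆ Icc α (α + l) ×ˢ Icc β' (β' + 2 ^ N * k))
    (hGs : G ⊆ Icc α' (α' + 2 ^ M * l) ×ˢ Icc β (β + k)) (q q' : ℕ × Fin 4) :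
    eLpNorm (fun p => extOp (chi (F ∩ farY β k q')) p * extOp (chi (G ∩ farX α l q)) p)
      (ENNReal.ofReal s) volume ≤ ENNReal.ofReal (vq e M q) * ENNReal.ofReal (vq e N q') *
      (ENNReal.ofReal A * ENNReal.ofReal ((l * (2 ^ M * l)) ^ (1 - 1 / s) * 2 ^ (-(e * M)) *
        ((k * (2 ^ N * k)) ^ (1 - 1 / s) * 2 ^ (-(e * N))))) := by
  set σ := 1 - 1 / s with hσd
  have hρ0 : 0 ≤ σ + e := by linarith
  set a := 2 ^ q.1 * l with ha
  set b := 2 ^ q'.1 * k with hb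
  have ha0 : 0 < a := by positivity
  have hb0 : 0 < b := by positivity
  have hla : l ≤ a := le_mul_of_one_le_left hl.le (one_le_pow₀ (by norm_num))
  have hkb : k ≤ b := le_mul_of_one_le_left hk.le (one_le_pow₀ (by norm_num))
  have hvF : volume (F ∩ farY β k q') ≤ ENNReal.ofReal (l * min (2 ^ N * k) b) := by
    rw [mul_min_of_nonneg _ _ hl.le, ENNReal.ofReal_min, le_min_iff]
    constructor
    · exact volume_rect_le (inter_subset_left.trans hFs) hl.le
    · refine volume_rect_le (a := α) (b := β + cc q'.2 * b) ?_ hl.le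
      rintro ξ ⟨h1, h2⟩
      refine ⟨(hFs h1).1, h2.1, ?_⟩
      have := h2.2.le
      rw [← hb] at this
      linarith
  have hvG : volume (G ∩ farX α l q) ≤ ENNReal.ofReal (min (2 ^ M * l) a * k) := by
    rw [min_mul_of_nonneg _ _ hk.le, ENNReal.ofReal_min, le_min_iff]
    constructor
    · exact volume_rect_le (inter_subset_left.trans hGs) (by positivity)
    · refine volume_rect_le (a := α + cc q.2 * a) (b := β) ?_ ha0.le
      rintro ξ ⟨h1, h2⟩
      refine ⟨⟨h2.1, ?_⟩, (hGs h1).2⟩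
      have := h2.2.le
      rw [← ha] at this
      linarith
  have hmain := BH_scaled (by linarith : 0 < s) hBH hρ0 hρ (a := a) (b := b) (α := α) (β := β)
    (c := cc q.2) (d := cc q'.2) ha0 hb0 (cc_abs _).1 (cc_abs _).2 (cc_abs _).1 (cc_abs _).2
    (hF.inter (measurableSet_farY β k q')) (hG.inter (measurableSet_farX α l q)) ?_ ?_
  · refine hmain.trans ?_
    have wM := weight_bound hσ he hl M q
    have wN := weight_bound hσ he hk N q'
    have m1 : 0 < min (2 ^ M * l) a := lt_min (by positivity) ha0
    have m2 : 0 < min (2 ^ N * k) b := lt_min (by positivity) hb0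
    have v1 : 0 ≤ vq e M q := by unfold vq; positivity
    have v2 : 0 ≤ vq e N q' := by unfold vq; positivity
    calc _ ≤ ENNReal.ofReal A * ENNReal.ofReal (a * b) ^ (2 * (1 - 1 / s) - 2 * (σ + e)) *
          (ENNReal.ofReal (l * min (2 ^ N * k) b) ^ (σ + e) *
            ENNReal.ofReal (min (2 ^ M * l) a * k) ^ (σ + e)) := by gcongr
      _ = ENNReal.ofReal A * ENNReal.ofReal ((a ^ (-(2 * e)) * l ^ (σ + e) *
            (min (2 ^ M * l) a) ^ (σ + e)) * (b ^ (-(2 * e)) * k ^ (σ + e) *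
            (min (2 ^ N * k) b) ^ (σ + e))) := by
          rw [ENNReal.ofReal_rpow_of_pos (by positivity), ENNReal.ofReal_rpow_of_pos (by positivity),
            ENNReal.ofReal_rpow_of_pos (by positivity)]
          refine ofReal_aux1 (by positivity) (by positivity) ?_
          rw [Real.mul_rpow ha0.le hb0.le, Real.mul_rpow hl.le m2.le, Real.mul_rpow m1.le hk.le]
          have : 2 * (1 - 1 / s) - 2 * (σ + e) = -(2 * e) := by rw [hσd]; ring
          rw [this]
          ring
      _ ≤ ENNReal.ofReal A * ENNReal.ofReal (((l * (2 ^ M * l)) ^ σ * 2 ^ (-(e * M)) * vq e M q) *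
            ((k * (2 ^ N * k)) ^ σ * 2 ^ (-(e * N)) * vq e N q')) := by
          gcongr
      _ = _ := by
          refine ofReal_aux2 v1 v2 ?_
          ring
  · rintro ξ ⟨h1, h2⟩
    have h3 := (hFs h1).1
    refine ⟨⟨h3.1, by linarith [h3.2]⟩, h2.1, h2.2.le⟩
  · rintro ξ ⟨h1, h2⟩
    have h3 := (hGs h1).2
    refine ⟨⟨h2.1, h2.2.le⟩, h3.1, by linarith [h3.2]⟩

theorem volume_ne_top_of_rect {F : Set (ℝ × ℝ)} {a b c d : ℝ}
    (h : F ⊆ Icc a (a + c) ×ˢ Icc b (b + d)) : volume F ≠ ∞ := by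
  refine ne_top_of_le_ne_top ?_ (measure_mono h)
  rw [Measure.volume_eq_prod, Measure.prod_prod, Real.volume_Icc, Real.volume_Icc]
  exact ENNReal.mul_ne_top ENNReal.ofReal_ne_top ENNReal.ofReal_ne_top

theorem far_part {s r A e : ℝ} (hs0 : 1 < s) (hBH : BH s r A)
    (he : 0 < e) (hσ : 2 * e ≤ 1 - 1 / s) (hρ : r ≤ 0 ∨ 1 - 1 / s + e ≤ 1 / r)
    {l k α α' β β' : ℝ} (hl : 0 < l) (hk : 0 < k) (M N : ℕ) {F G : Set (ℝ × ℝ)}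
    (hF : MeasurableSet F) (hG : MeasurableSet G)
    (hFs : F ⊆ Icc α (α + l) ×ˢ Icc β' (β' + 2 ^ N * k))
    (hGs : G ⊆ Icc α' (α' + 2 ^ M * l) ×ˢ Icc β (β + k)) :
    eLpNorm (fun p => extOp (chi (F ∩ ⋃ q, farY β k q)) p * extOp (chi (G ∩ ⋃ q, farX α l q)) p)
      (ENNReal.ofReal s) volume ≤ (4 * Ce e) * (4 * Ce e) *
      (ENNReal.ofReal A * ENNReal.ofReal ((l * (2 ^ M * l)) ^ (1 - 1 / s) * 2 ^ (-(e * M)) *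
        ((k * (2 ^ N * k)) ^ (1 - 1 / s) * 2 ^ (-(e * N))))) := by
  have hprod := tsum_prod_mul' (fun q => ENNReal.ofReal (vq e M q))
    (fun q => ENNReal.ofReal (vq e N q))
  have hle := mul_le_mul' (tsum_vq e M) (tsum_vq e N)
  have hct : 4 * Ce e ≠ ∞ := ENNReal.mul_ne_top (by norm_num) (Ce_ne_top he)
  have h := minkowski_tsum (s := s) hs0.le
    (G := fun p => extOp (chi (F ∩ ⋃ q, farY β k q)) p * extOp (chi (G ∩ ⋃ q, farX α l q)) p)
    (H := fun (Q : (ℕ × Fin 4) × (ℕ × Fin 4)) p =>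
      extOp (chi (F ∩ farY β k Q.2)) p * extOp (chi (G ∩ farX α l Q.1)) p) ?_
    (fun Q => ENNReal.ofReal (vq e M Q.1) * ENNReal.ofReal (vq e N Q.2)) _ ?_ ?_ ?_
    (fun Q => far_piece hs0 hBH he hσ hρ hl hk M N hF hG hFs hGs Q.1 Q.2)
  · refine h.trans ?_
    rw [hprod]
    gcongr
  · intro Q
    exact (measurable_extOp (measurable_chi (hF.inter (measurableSet_farY _ _ _)))).mul
      (measurable_extOp (measurable_chi (hG.inter (measurableSet_farX _ _ _))))
  · rw [hprod]
    exact ne_top_of_le_ne_top (ENNReal.mul_ne_top hct hct) hle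
  · intro p
    have h1 := (hasSum_extOp_chi hF (volume_ne_top_of_rect hFs) (measurableSet_farY β k)
      (fun q q' ξ h1 h2 => IP_inj hk h1 h2) p).tsum_eq
    have h2 := (hasSum_extOp_chi hG (volume_ne_top_of_rect hGs) (measurableSet_farX α l)
      (fun q q' ξ h1 h2 => IP_inj hl h1 h2) p).tsum_eq
    rw [← h1, ← h2]
    simp_rw [enorm_mul]
    simp_rw [mul_comm ‖extOp (chi (F ∩ farY β k _)) p‖ₑ]
    rw [tsum_prod_mul' (fun q => ‖extOp (chi (G ∩ farX α l q)) p‖ₑ)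
      (fun q => ‖extOp (chi (F ∩ farY β k q)) p‖ₑ), mul_comm]
    exact mul_le_mul' enorm_tsum_le_tsum_enorm enorm_tsum_le_tsum_enorm
  · intro Q hQ
    exfalso
    have v1 : 0 < vq e M Q.1 := by unfold vq; positivity
    have v2 : 0 < vq e N Q.2 := by unfold vq; positivity
    rcases mul_eq_zero.1 hQ with h | h <;> rw [ENNReal.ofReal_eq_zero] at h <;> linarith

open MeasureTheory Set
open scoped ENNReal

theorem holder_two {s : ℝ} (hs : 0 < s) {f g : ℝ × ℝ × ℝ → ℂ} (hf : Measurable f)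
    (hg : Measurable g) :
    eLpNorm (fun p => f p * g p) (ENNReal.ofReal s) volume ≤
      eLpNorm f (ENNReal.ofReal (2 * s)) volume * eLpNorm g (ENNReal.ofReal (2 * s)) volume := by
  have h2 : (0 : ℝ) < 2 * s := by linarith
  rw [eLp_eq hs, eLp_eq h2, eLp_eq h2]
  have h := ENNReal.lintegral_mul_le_Lp_mul_Lq (volume : Measure (ℝ × ℝ × ℝ))
    (p := 2) (q := 2) Real.HolderConjugate.two_two
    (f := fun p => ‖f p‖ₑ ^ s) (g := fun p => ‖g p‖ₑ ^ s)
    (hf.enorm.pow_const s).aemeasurable (hg.enorm.pow_const s).aemeasurable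
  have h' := ENNReal.rpow_le_rpow h (by positivity : (0 : ℝ) ≤ 1 / s)
  rw [ENNReal.mul_rpow_of_nonneg _ _ (by positivity)] at h'
  simp only [Pi.mul_apply, ← ENNReal.rpow_mul] at h'
  simp only [enorm_mul, ENNReal.mul_rpow_of_nonneg _ _ hs.le]
  have e1 : (1 : ℝ) / 2 * (1 / s) = 1 / (2 * s) := by field_simp
  rw [e1, mul_comm s 2] at h'
  exact h'

theorem extOp_split {F T : Set (ℝ × ℝ)} (hF : MeasurableSet F) (hFv : volume F ≠ ∞)
    (hT : MeasurableSet T) (p : ℝ × ℝ × ℝ) :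
    extOp (chi F) p = extOp (chi (F \ T)) p + extOp (chi (F ∩ T)) p := by
  rw [extOp_chi hF, extOp_chi (hF.diff hT), extOp_chi (hF.inter hT), add_comm]
  exact (integral_inter_add_sdiff hT (integrableOn_ph hFv p)).symm

theorem ofReal_gain {σ e v t : ℝ} {n : ℕ} (hσ : 0 ≤ σ) (hv : 0 < v) {W : ℝ≥0∞}
    (hW : ENNReal.ofReal v ≤ W) (het : e * t ≤ n * σ) :
    ENNReal.ofReal (64 * (2 : ℝ) ^ (-(n : ℝ)) * v) ^ σ ≤
      ENNReal.ofReal ((64 : ℝ) ^ σ) * ENNReal.ofReal ((2 : ℝ) ^ (-(e * t))) * W ^ σ := by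
  rw [ENNReal.ofReal_mul (by positivity), ENNReal.ofReal_mul (by positivity),
    ENNReal.mul_rpow_of_nonneg _ _ hσ, ENNReal.mul_rpow_of_nonneg _ _ hσ,
    ENNReal.ofReal_rpow_of_pos (by positivity), ENNReal.ofReal_rpow_of_pos (by positivity)]
  gcongr
  rw [← Real.rpow_mul (by norm_num)]
  apply Real.rpow_le_rpow_of_exponent_le (by norm_num)
  linarith

theorem main_abs {s r A e CV : ℝ} (hs1 : 3 / 2 < s) (hs2 : s < 2) (hBH : BH s r A)
    (he : 0 < e) (hσ : 2 * e ≤ 1 - 1 / s) (hρ : r ≤ 0 ∨ 1 - 1 / s + e ≤ 1 / r)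
    {l k α α' β β' : ℝ} (hl : 0 < l) (hk : 0 < k) (M N : ℕ) (hMN : (N : ℝ) / 2 ≤ M)
    {F G Ω Ω' : Set (ℝ × ℝ)}
    (hF : MeasurableSet F) (hG : MeasurableSet G) (hFΩ : F ⊆ Ω) (hGΩ : G ⊆ Ω')
    (hFs : F ⊆ Icc α (α + l) ×ˢ Icc β' (β' + 2 ^ N * k))
    (hGs : G ⊆ Icc α' (α' + 2 ^ M * l) ×ˢ Icc β (β + k))
    (hW : ENNReal.ofReal (l * (2 ^ N * k) / 4) ≤ volume Ω)
    (hW' : ENNReal.ofReal (2 ^ M * l * k / 4) ≤ volume Ω')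
    (hV : VargasBound s Ω CV) (hV' : VargasBound s Ω' CV) :
    eLpNorm (fun p => extOp (chi F) p * extOp (chi G) p) (ENNReal.ofReal s) volume ≤
      (CL s A ^ (1 / 2 : ℝ) * ENNReal.ofReal ((64 : ℝ) ^ (1 - 1 / s)) * ENNReal.ofReal CV +
        CL s A ^ (1 / 2 : ℝ) * ENNReal.ofReal ((64 : ℝ) ^ (1 - 1 / s)) * ENNReal.ofReal CV +
        (4 * Ce e) * (4 * Ce e) * (ENNReal.ofReal A * ENNReal.ofReal ((16 : ℝ) ^ (1 - 1 / s)))) *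
      ENNReal.ofReal ((2 : ℝ) ^ (-(e * N))) *
        (volume Ω ^ (1 - 1 / s) * volume Ω' ^ (1 - 1 / s)) := by
  have hs0 : 0 < s := by linarith
  have hfar := far_part (by linarith) hBH he hσ hρ hl hk M N hF hG hFs hGs
  set σ := 1 - 1 / s with hσd
  have hσ0 : 0 ≤ σ := by linarith
  set TY := ⋃ q, farY β k q with hTY
  set TX := ⋃ q, farX α l q with hTX
  have mTY : MeasurableSet TY := MeasurableSet.iUnion (measurableSet_farY β k)
  have mTX : MeasurableSet TX := MeasurableSet.iUnion (measurableSet_farX α l)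
  have hFv := volume_ne_top_of_rect hFs
  have hGv := volume_ne_top_of_rect hGs
  have me : ∀ {S : Set (ℝ × ℝ)}, MeasurableSet S → Measurable (extOp (chi S)) :=
    fun h => measurable_extOp (measurable_chi h)
  have N0 : (0 : ℝ) ≤ N := Nat.cast_nonneg N
  have M0 : (0 : ℝ) ≤ M := Nat.cast_nonneg M
  -- near parts
  have nF : eLpNorm (extOp (chi (F \ TY))) (ENNReal.ofReal (2 * s)) volume ≤
      CL s A ^ (1 / 2 : ℝ) * (ENNReal.ofReal ((64 : ℝ) ^ σ) *
        ENNReal.ofReal ((2 : ℝ) ^ (-(e * N))) * volume Ω ^ σ) := by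
    refine (lin_rect hs1 hs2 hBH (a := l) (b := 4 * k) (α := α) (β := β - 2 * k) hl (by linarith)
      (hF.diff mTY) ?_).trans ?_
    · rintro ξ ⟨h1, h2⟩
      have h3 := (hFs h1).1
      refine ⟨⟨h3.1, h3.2⟩, ?_⟩
      have : ¬ (ξ.2 < β - 2 * k ∨ β + 2 * k ≤ ξ.2) := by
        intro h
        obtain ⟨q, hq⟩ := IP_cover hk h
        exact h2 (mem_iUnion.2 ⟨q, hq⟩)
      push Not at this
      exact ⟨this.1, by linarith [this.2]⟩
    · gcongr
      refine le_trans (le_of_eq ?_) (ofReal_gain (n := N) hσ0 (by positivity) hW (by nlinarith))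
      congr 2
      rw [Real.rpow_neg (by norm_num), Real.rpow_natCast]
      field_simp
      norm_num
  have nG : eLpNorm (extOp (chi (G \ TX))) (ENNReal.ofReal (2 * s)) volume ≤
      CL s A ^ (1 / 2 : ℝ) * (ENNReal.ofReal ((64 : ℝ) ^ σ) *
        ENNReal.ofReal ((2 : ℝ) ^ (-(e * N))) * volume Ω' ^ σ) := by
    refine (lin_rect hs1 hs2 hBH (a := 4 * l) (b := k) (α := α - 2 * l) (β := β) (by linarith) hk
      (hG.diff mTX) ?_).trans ?_
    · rintro ξ ⟨h1, h2⟩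
      have h3 := (hGs h1).2
      refine ⟨?_, ⟨h3.1, h3.2⟩⟩
      have : ¬ (ξ.1 < α - 2 * l ∨ α + 2 * l ≤ ξ.1) := by
        intro h
        obtain ⟨q, hq⟩ := IP_cover hl h
        exact h2 (mem_iUnion.2 ⟨q, hq⟩)
      push Not at this
      exact ⟨this.1, by linarith [this.2]⟩
    · gcongr
      refine le_trans (le_of_eq ?_) (ofReal_gain (n := M) hσ0 (by positivity) hW' (by nlinarith))
      congr 2
      rw [Real.rpow_neg (by norm_num), Real.rpow_natCast]
      field_simp
      norm_num
  have vG := hV' G hGΩ hG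
  have vF := hV (F ∩ TY) (inter_subset_left.trans hFΩ) (hF.inter mTY)
  have p1 := (holder_two hs0 (me (hF.diff mTY)) (me hG)).trans (mul_le_mul' nF vG)
  have p2 := (holder_two hs0 (me (hF.inter mTY)) (me (hG.diff mTX))).trans (mul_le_mul' vF nG)
  have p3 : ENNReal.ofReal ((l * (2 ^ M * l)) ^ σ * 2 ^ (-(e * M)) *
        ((k * (2 ^ N * k)) ^ σ * 2 ^ (-(e * N)))) ≤
      ENNReal.ofReal ((16 : ℝ) ^ σ) * ENNReal.ofReal ((2 : ℝ) ^ (-(e * N))) *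
        (volume Ω ^ σ * volume Ω' ^ σ) := by
    calc _ ≤ ENNReal.ofReal ((16 : ℝ) ^ σ * (2 : ℝ) ^ (-(e * N)) *
          ((l * (2 ^ N * k) / 4) ^ σ * (2 ^ M * l * k / 4) ^ σ)) := by
          apply ENNReal.ofReal_le_ofReal
          have h1 : (2 : ℝ) ^ (-(e * M)) ≤ 1 :=
            Real.rpow_le_one_of_one_le_of_nonpos (by norm_num) (by nlinarith)
          have h2 : (l * (2 ^ M * l)) ^ σ * (k * (2 ^ N * k)) ^ σ =
              (16 : ℝ) ^ σ * ((l * (2 ^ N * k) / 4) ^ σ * (2 ^ M * l * k / 4) ^ σ) := by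
            rw [← Real.mul_rpow (by positivity) (by positivity),
              ← Real.mul_rpow (by positivity) (by positivity),
              ← Real.mul_rpow (by positivity) (by positivity)]
            congr 1
            ring
          calc _ = (2 : ℝ) ^ (-(e * M)) * (2 ^ (-(e * N)) *
                ((l * (2 ^ M * l)) ^ σ * (k * (2 ^ N * k)) ^ σ)) := by ring
            _ ≤ 1 * (2 ^ (-(e * N)) *
                ((l * (2 ^ M * l)) ^ σ * (k * (2 ^ N * k)) ^ σ)) := by gcongr
            _ = _ := by rw [h2]; ring
      _ = ENNReal.ofReal ((16 : ℝ) ^ σ) * ENNReal.ofReal ((2 : ℝ) ^ (-(e * N))) *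
          (ENNReal.ofReal (l * (2 ^ N * k) / 4) ^ σ * ENNReal.ofReal (2 ^ M * l * k / 4) ^ σ) := by
          rw [ENNReal.ofReal_mul (by positivity), ENNReal.ofReal_mul (by positivity),
            ENNReal.ofReal_mul (by positivity), ENNReal.ofReal_rpow_of_pos (by positivity),
            ENNReal.ofReal_rpow_of_pos (by positivity)]
      _ ≤ _ := by gcongr
  have p3' := hfar.trans (mul_le_mul_right (mul_le_mul_right p3 _) _)
  have hsum : (fun p => extOp (chi F) p * extOp (chi G) p) =
      (fun p => extOp (chi (F \ TY)) p * extOp (chi G) p) +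
      ((fun p => extOp (chi (F ∩ TY)) p * extOp (chi (G \ TX)) p) +
       (fun p => extOp (chi (F ∩ TY)) p * extOp (chi (G ∩ TX)) p)) := by
    funext p
    simp only [Pi.add_apply]
    rw [extOp_split hF hFv mTY p, extOp_split hG hGv mTX p]
    ring
  have h1s : (1 : ℝ≥0∞) ≤ ENNReal.ofReal s := by
    rw [ENNReal.one_le_ofReal]; linarith
  have m1 := ((me (hF.diff mTY)).mul (me hG))
  have m2 := ((me (hF.inter mTY)).mul (me (hG.diff mTX)))
  have m3 := ((me (hF.inter mTY)).mul (me (hG.inter mTX)))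
  rw [hsum]
  refine (eLpNorm_add_le m1.aestronglyMeasurable (m2.add m3).aestronglyMeasurable h1s).trans ?_
  refine (add_le_add p1 ((eLpNorm_add_le m2.aestronglyMeasurable m3.aestronglyMeasurable
    h1s).trans (add_le_add p2 p3'))).trans (le_of_eq ?_)
  ring

theorem vol_lower {Ω : Set (ℝ × ℝ)} (hΩ : MeasurableSet Ω) {u v : ℝ≥0∞}
    (hf : ∀ x : ℝ, (vFiber Ω x).Nonempty → u ≤ volume (vFiber Ω x))
    (hp : v ≤ volume (Prod.fst '' Ω)) : u * v ≤ volume Ω := by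
  rw [Measure.volume_eq_prod, Measure.prod_apply hΩ]
  have hm := measurable_measure_prodMk_left (ν := (volume : Measure ℝ)) hΩ
  refine le_trans ?_ (mul_meas_ge_le_lintegral hm u)
  gcongr
  refine hp.trans (measure_mono ?_)
  rintro x ⟨ξ, h, rfl⟩
  exact hf ξ.1 ⟨ξ.2, h⟩

theorem two_zpow_ofReal (n : ℤ) : (2 : ℝ≥0∞) ^ n = ENNReal.ofReal ((2 : ℝ) ^ n) := by
  rw [← Real.rpow_intCast, ← ENNReal.ofReal_rpow_of_pos (by norm_num), ENNReal.rpow_intCast]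
  simp

theorem exists_e {s r : ℝ} (hs₁ : 3 / 2 < s) (hr : r < s / (s - 1)) :
    ∃ e : ℝ, 0 < e ∧ 2 * e ≤ 1 - 1 / s ∧ (r ≤ 0 ∨ 1 - 1 / s + e ≤ 1 / r) := by
  have hs0 : 0 < s := by linarith
  have hσ : 0 < 1 - 1 / s := by
    rw [sub_pos, div_lt_one hs0]; linarith
  by_cases h : r ≤ 0
  · exact ⟨(1 - 1 / s) / 2, by linarith, by linarith, Or.inl h⟩
  · push Not at h
    have h1 : 1 - 1 / s < 1 / r := by
      rw [lt_div_iff₀ (by linarith)] at hr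
      rw [lt_div_iff₀ h]
      have : (1 - 1 / s) * r = r * (s - 1) / s := by field_simp
      rw [this, div_lt_one hs0]
      exact hr
    refine ⟨min ((1 - 1 / s) / 2) (1 / r - (1 - 1 / s)), lt_min (by linarith) (by linarith), ?_,
      Or.inr ?_⟩
    · linarith [min_le_left ((1 - 1 / s) / 2) (1 / r - (1 - 1 / s))]
    · linarith [min_le_right ((1 - 1 / s) / 2) (1 / r - (1 - 1 / s))]

theorem tile_subset (j k m m' : ℤ) : tile j k m m' ⊆
    Icc ((m : ℝ) * 2 ^ (-j)) ((m : ℝ) * 2 ^ (-j) + 2 ^ (-j)) ×ˢ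
    Icc ((m' : ℝ) * 2 ^ (-k)) ((m' : ℝ) * 2 ^ (-k) + 2 ^ (-k)) := by
  unfold tile dyadicIcc
  rw [add_mul, add_mul, one_mul, one_mul]

theorem measurableSet_tile (j k m m' : ℤ) : MeasurableSet (tile j k m m') :=
  measurableSet_Icc.prod measurableSet_Icc

/-- key single-tile bilinear estimate with decay: under BH(s,r) with
`3/2 < s < 2`, `r < s'`, and a Vargas constant `CV`, there are admissible constants
`C, c₀, C₃ > 0` such that the following holds.  Let `K < K'`, `J > J'` be nonnegative
integers; let `Ω(K) ⊆ [0,1]²` be measurable with all nonempty vertical fibers of measure in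
`[2^{-K-1}, 2^{-K+1}]` and `2^{-J-1} ≤ |π₁(Ω(K))| ≤ 2^{-J+1}`, satisfying Vargas's estimate
with constant `CV`, and similarly for `Ω(K')` with parameters `K', J'`; assume
`|J - J'| ≥ |K - K'|/2`.  Then for any tiles `τ ∈ 𝓓_{J,K}`, `τ' ∈ 𝓓_{J',K'}` and any dyadic
`0 < δ ≤ 1`,
`∥𝓔χ_{τ∩Ω(K)}·𝓔χ_{τ'∩Ω(K')}∥_{L^s} ≤ C₃ δ^{-C} 2^{-c₀|K-K'|} |Ω(K)|^{1/s'} |Ω(K')|^{1/s'}`. -/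
theorem stmt12 (s r A CV : ℝ) (hs₁ : 3 / 2 < s) (hs₂ : s < 2) (hr : r < s / (s - 1))
    (hBH : BH s r A) (hCV : 0 < CV) :
    ∃ C c₀ C₃ : ℝ, 0 < C ∧ 0 < c₀ ∧ 0 < C₃ ∧
      ∀ (K K' J J' : ℕ) (ΩK ΩK' : Set (ℝ × ℝ)),
        K < K' → J' < J →
        MeasurableSet ΩK → ΩK ⊆ Icc 0 1 ×ˢ Icc 0 1 →
        MeasurableSet ΩK' → ΩK' ⊆ Icc 0 1 ×ˢ Icc 0 1 →
        (∀ x : ℝ, (vFiber ΩK x).Nonempty →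
          (2 : ℝ≥0∞) ^ (-(K : ℤ) - 1) ≤ volume (vFiber ΩK x) ∧
            volume (vFiber ΩK x) ≤ (2 : ℝ≥0∞) ^ (-(K : ℤ) + 1)) →
        (2 : ℝ≥0∞) ^ (-(J : ℤ) - 1) ≤ volume (Prod.fst '' ΩK) →
        volume (Prod.fst '' ΩK) ≤ (2 : ℝ≥0∞) ^ (-(J : ℤ) + 1) →
        (∀ x : ℝ, (vFiber ΩK' x).Nonempty →
          (2 : ℝ≥0∞) ^ (-(K' : ℤ) - 1) ≤ volume (vFiber ΩK' x) ∧
            volume (vFiber ΩK' x) ≤ (2 : ℝ≥0∞) ^ (-(K' : ℤ) + 1)) →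
        (2 : ℝ≥0∞) ^ (-(J' : ℤ) - 1) ≤ volume (Prod.fst '' ΩK') →
        volume (Prod.fst '' ΩK') ≤ (2 : ℝ≥0∞) ^ (-(J' : ℤ) + 1) →
        VargasBound s ΩK CV → VargasBound s ΩK' CV →
        |(K : ℝ) - (K' : ℝ)| / 2 ≤ |(J : ℝ) - (J' : ℝ)| →
        ∀ (m m' n n' : ℤ) (δ : ℝ), IsDyadic δ → 0 < δ → δ ≤ 1 →
          eLpNorm (fun p => extOp (chi (tile (J : ℤ) (K : ℤ) m m' ∩ ΩK)) p *
              extOp (chi (tile (J' : ℤ) (K' : ℤ) n n' ∩ ΩK')) p)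
              (ENNReal.ofReal s) volume ≤
            ENNReal.ofReal (C₃ * δ ^ (-C) * 2 ^ (-(c₀ * |(K : ℝ) - (K' : ℝ)|))) *
              (volume ΩK ^ (1 - 1 / s) * volume ΩK' ^ (1 - 1 / s)) := by
  obtain ⟨e, he, hσ, hρ⟩ := exists_e hs₁ hr
  have hs0 : 0 < s := by linarith
  set CT : ℝ≥0∞ :=
    (CL s A ^ (1 / 2 : ℝ) * ENNReal.ofReal ((64 : ℝ) ^ (1 - 1 / s)) * ENNReal.ofReal CV +
        CL s A ^ (1 / 2 : ℝ) * ENNReal.ofReal ((64 : ℝ) ^ (1 - 1 / s)) * ENNReal.ofReal CV +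
        (4 * Ce e) * (4 * Ce e) *
          (ENNReal.ofReal A * ENNReal.ofReal ((16 : ℝ) ^ (1 - 1 / s)))) with hCT
  have hCTtop : CT ≠ ∞ := by
    have h1 : CL s A ^ (1 / 2 : ℝ) ≠ ∞ :=
      ENNReal.rpow_ne_top_of_nonneg (by norm_num) (CL_ne_top hs₁)
    have h2 : 4 * Ce e ≠ ∞ := ENNReal.mul_ne_top (by norm_num) (Ce_ne_top he)
    have h3 := ENNReal.mul_ne_top (ENNReal.mul_ne_top h1
      (ENNReal.ofReal_ne_top (r := (64 : ℝ) ^ (1 - 1 / s)))) (ENNReal.ofReal_ne_top (r := CV))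
    exact ENNReal.add_ne_top.2 ⟨ENNReal.add_ne_top.2 ⟨h3, h3⟩,
      ENNReal.mul_ne_top (ENNReal.mul_ne_top h2 h2)
        (ENNReal.mul_ne_top ENNReal.ofReal_ne_top ENNReal.ofReal_ne_top)⟩
  refine ⟨1, e, CT.toReal + 1, one_pos, he, by positivity, ?_⟩
  intro K K' J J' ΩK ΩK' hK hJ hm hsub hm' hsub' hfib hp1 hp2 hfib' hp1' hp2' hV hV' hKJ
    m m' n n' δ hδd hδ0 hδ1
  have e2 : ∀ a b : ℕ, a < b → (2 : ℝ) ^ (b - a) * 2 ^ (-(b : ℤ)) = 2 ^ (-(a : ℤ)) := by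
    intro a b hab
    rw [← zpow_natCast, ← zpow_add₀ (by norm_num)]
    congr 1
    push_cast [hab.le]
    ring
  have eJ := e2 J' J hJ
  have eK := e2 K K' hK
  have half : ∀ a b : ℕ, (2 : ℝ≥0∞) ^ (-(b : ℤ) - 1) * (2 : ℝ≥0∞) ^ (-(a : ℤ) - 1) =
      ENNReal.ofReal ((2 : ℝ) ^ (-(a : ℤ)) * 2 ^ (-(b : ℤ)) / 4) := by
    intro a b
    rw [two_zpow_ofReal, two_zpow_ofReal, ← ENNReal.ofReal_mul (by positivity)]
    congr 1
    rw [zpow_sub₀ (by norm_num), zpow_sub₀ (by norm_num)]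
    ring
  have hKc : (K : ℝ) < K' := by exact_mod_cast hK
  have hJc : (J' : ℝ) < J := by exact_mod_cast hJ
  have aK : |(K : ℝ) - (K' : ℝ)| = ((K' - K : ℕ) : ℝ) := by
    rw [abs_of_neg (by linarith), Nat.cast_sub hK.le]; ring
  have aJ : |(J : ℝ) - (J' : ℝ)| = ((J - J' : ℕ) : ℝ) := by
    rw [abs_of_pos (by linarith), Nat.cast_sub hJ.le]
  rw [aK, aJ] at hKJ
  have key := main_abs (Ω := ΩK) (Ω' := ΩK') (F := tile (J : ℤ) (K : ℤ) m m' ∩ ΩK)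
    (G := tile (J' : ℤ) (K' : ℤ) n n' ∩ ΩK') hs₁ hs₂ hBH he hσ hρ
    (l := 2 ^ (-(J : ℤ))) (k := 2 ^ (-(K' : ℤ))) (by positivity) (by positivity)
    (J - J') (K' - K) hKJ ((measurableSet_tile _ _ _ _).inter hm)
    ((measurableSet_tile _ _ _ _).inter hm') inter_subset_right inter_subset_right
    (α := (m : ℝ) * 2 ^ (-(J : ℤ))) (β' := (m' : ℝ) * 2 ^ (-(K : ℤ)))
    (α' := (n : ℝ) * 2 ^ (-(J' : ℤ))) (β := (n' : ℝ) * 2 ^ (-(K' : ℤ)))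
    (by rw [eK]; exact inter_subset_left.trans (tile_subset _ _ _ _))
    (by rw [eJ]; exact inter_subset_left.trans (tile_subset _ _ _ _))
    (by
      rw [eK, ← half]
      exact vol_lower hm (fun x hx => (hfib x hx).1) hp1)
    (by
      rw [eJ, ← half]
      exact vol_lower hm' (fun x hx => (hfib' x hx).1) hp1')
    hV hV'
  refine key.trans ?_
  rw [← hCT, aK]
  gcongr
  rw [← ENNReal.ofReal_toReal hCTtop, ← ENNReal.ofReal_mul ENNReal.toReal_nonneg]
  apply ENNReal.ofReal_le_ofReal
  have hδ : 1 ≤ δ ^ (-(1 : ℝ)) := Real.one_le_rpow_of_pos_of_le_one_of_nonpos hδ0 hδ1 (by norm_num)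
  have h0 : 0 ≤ CT.toReal := ENNReal.toReal_nonneg
  gcongr
  rw [ENNReal.toReal_ofReal h0]
  nlinarith
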